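/- arXiv:2210.14878 — 5 statements merged into one kernel-verified Lean document; each statement's English description precedes it below -/
import Mathlib

section
/- The set S = {L : ρ(A − L·H) < 1} of Schur-stabilizing gains is an open subset of the space of n×m real matrices, and the function J is real-analytic on S (i.e., L ↦ tr(X(L)·Hᵀ·H) + tr(R) is AnalyticOn ℝ on S). -/
open Matrix Filter Topology

attribute [local instance] Matrix.normedAddCommGroup Matrix.normedSpace

/-- Spectral radius of a real square matrix: the maximum modulus of its complex
eigenvalues, i.e. the spectral radius of the matrix viewed over `ℂ`. -/
noncomputable def specRad {n : ℕ} (M : Matrix (Fin n) (Fin n) ℝ) : ENNReal :=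
  spectralRadius ℂ (M.map (Complex.ofReal))

theorem eventually_nnnorm_pow_le_of_spectralRadius_lt_one {𝔸 : Type*} [NormedRing 𝔸]
    [NormedAlgebra ℂ 𝔸] [CompleteSpace 𝔸] {a : 𝔸} (ha : spectralRadius ℂ a < 1) :
    ∃ q : NNReal, q < 1 ∧ ∀ᶠ k : ℕ in atTop, ‖a ^ k‖₊ ≤ q ^ k := by
  obtain ⟨q, h₁, h₂⟩ := ENNReal.lt_iff_exists_nnreal_btwn.1 ha
  refine ⟨q, by exact_mod_cast h₂, ?_⟩
  filter_upwards [(spectrum.pow_nnnorm_pow_one_div_tendsto_nhds_spectralRadius a).eventually_lt_const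
    h₁, eventually_gt_atTop 0] with k hk hk0
  have hk0' : (0 : ℝ) < k := by exact_mod_cast hk0
  have h := ENNReal.rpow_le_rpow hk.le hk0'.le
  rw [← ENNReal.rpow_mul, one_div_mul_cancel hk0'.ne', ENNReal.rpow_one, ENNReal.rpow_natCast] at h
  exact_mod_cast h

theorem isOpen_setOf_spectralRadius_lt_one (𝔸 : Type*) [NormedRing 𝔸]
    [NormedAlgebra ℂ 𝔸] [CompleteSpace 𝔸] : IsOpen {a : 𝔸 | spectralRadius ℂ a < 1} := by
  refine isOpen_iff_mem_nhds.2 fun a ha ↦ ?_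
  obtain ⟨q, hq, hk⟩ := eventually_nnnorm_pow_le_of_spectralRadius_lt_one ha
  have hlim : Tendsto (fun k : ℕ ↦ q ^ k * ‖(1 : 𝔸)‖₊) atTop (𝓝 0) := by
    simpa using (NNReal.tendsto_pow_atTop_nhds_zero_of_lt_one hq).mul_const ‖(1 : 𝔸)‖₊
  obtain ⟨N, hN⟩ := eventually_atTop.1 (hk.and (hlim.eventually_lt_const zero_lt_one))
  obtain ⟨h₁, h₂⟩ := hN (N + 1) (by simp)
  have hlt : ‖a ^ (N + 1)‖₊ * ‖(1 : 𝔸)‖₊ < 1 := (mul_le_mul_left h₁ _).trans_lt h₂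
  have hcont : Continuous fun b : 𝔸 ↦ ‖b ^ (N + 1)‖₊ * ‖(1 : 𝔸)‖₊ := by fun_prop
  filter_upwards [hcont.continuousAt.eventually_lt_const hlt] with b hb
  refine (spectrum.spectralRadius_le_pow_nnnorm_pow_one_div ℂ b N).trans_lt ?_
  have hpos : (0 : ℝ) < 1 / (N + 1) := by positivity
  rw [← ENNReal.mul_rpow_of_nonneg _ _ hpos.le]
  exact ENNReal.rpow_lt_one (by exact_mod_cast hb) hpos

section LinftyOp

attribute [local instance] Matrix.linftyOpNormedRing Matrix.linftyOpNormedAlgebra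

theorem isOpen_setOf_matrix_spectralRadius_lt_one (n : ℕ) :
    IsOpen {M : Matrix (Fin n) (Fin n) ℂ | spectralRadius ℂ M < 1} :=
  @isOpen_setOf_spectralRadius_lt_one (Matrix (Fin n) (Fin n) ℂ) _ _
    (inferInstance : CompleteSpace (Fin n → Fin n → ℂ))

theorem eventually_norm_entry_pow_le {n : ℕ} {M : Matrix (Fin n) (Fin n) ℂ}
    (hM : spectralRadius ℂ M < 1) :
    ∃ q : NNReal, q < 1 ∧ ∀ᶠ k : ℕ in atTop, ∀ i j, ‖(M ^ k) i j‖₊ ≤ q ^ k := by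
  obtain ⟨q, hq, hk⟩ := @eventually_nnnorm_pow_le_of_spectralRadius_lt_one
    (Matrix (Fin n) (Fin n) ℂ) _ _ (inferInstance : CompleteSpace (Fin n → Fin n → ℂ)) M hM
  refine ⟨q, hq, hk.mono fun k hk i j ↦ ?_⟩
  refine le_trans ?_ hk
  rw [Matrix.linfty_opNNNorm_def]
  exact (Finset.single_le_sum (f := fun j ↦ ‖(M ^ k) i j‖₊) (fun _ _ ↦ zero_le)
    (Finset.mem_univ j)).trans (Finset.le_sup (f := fun i ↦ ∑ j, ‖(M ^ k) i j‖₊)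
      (Finset.mem_univ i))

end LinftyOp

theorem isOpen_setOf_specRad_lt_one (n : ℕ) :
    IsOpen {M : Matrix (Fin n) (Fin n) ℝ | specRad M < 1} :=
  (isOpen_setOf_matrix_spectralRadius_lt_one n).preimage
    (continuous_id.matrix_map Complex.continuous_ofReal)

theorem eventually_norm_entry_pow_le_of_specRad_lt_one {n : ℕ} {M : Matrix (Fin n) (Fin n) ℝ}
    (hM : specRad M < 1) :
    ∃ q : ℝ, 0 ≤ q ∧ q < 1 ∧ ∀ᶠ k : ℕ in atTop, ∀ i j, |(M ^ k) i j| ≤ q ^ k := by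
  obtain ⟨q, hq, hk⟩ := eventually_norm_entry_pow_le hM
  refine ⟨q, q.2, by exact_mod_cast hq, hk.mono fun k hk i j ↦ ?_⟩
  have h : M.map Complex.ofReal ^ k = (M ^ k).map Complex.ofReal :=
    (Matrix.map_pow M Complex.ofRealHom k).symm
  have := hk i j
  rw [h, Matrix.map_apply, ← NNReal.coe_le_coe] at this
  simpa using this

theorem summable_lyapunov {n : ℕ} {M : Matrix (Fin n) (Fin n) ℝ} (hM : specRad M < 1)
    (B : Matrix (Fin n) (Fin n) ℝ) : Summable fun t : ℕ ↦ M ^ t * B * Mᵀ ^ t := by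
  obtain ⟨q, hq0, hq1, hk⟩ := eventually_norm_entry_pow_le_of_specRad_lt_one hM
  refine Pi.summable.2 fun i ↦ Pi.summable.2 fun j ↦ ?_
  simp only [Matrix.mul_apply, ← Matrix.transpose_pow, Matrix.transpose_apply, Finset.sum_mul]
  refine summable_sum fun b _ ↦ summable_sum fun a _ ↦ ?_
  refine Summable.of_norm_bounded_eventually_nat (g := fun t ↦ q ^ t * |B a b|)
    ((summable_geometric_of_lt_one hq0 hq1).mul_right _) ?_
  filter_upwards [hk] with t ht
  rw [norm_mul, norm_mul, Real.norm_eq_abs, Real.norm_eq_abs, Real.norm_eq_abs]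
  have h1 : |(M ^ t) j b| ≤ 1 := (ht j b).trans (pow_le_one₀ hq0 hq1.le)
  calc |(M ^ t) i a| * |B a b| * |(M ^ t) j b|
      ≤ q ^ t * |B a b| * 1 := by gcongr; exact ht i a
    _ = _ := mul_one _

/-- The matrix of the operator `X ↦ X - M X Mᵀ` acting on vectorized matrices. -/
noncomputable def steinMatrix {n : ℕ} (M : Matrix (Fin n) (Fin n) ℝ) :
    Matrix (Fin n × Fin n) (Fin n × Fin n) ℝ :=
  1 - Matrix.kroneckerMap (· * ·) M M

theorem steinMatrix_mulVec_vec {n : ℕ} (M X : Matrix (Fin n) (Fin n) ℝ) :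
    steinMatrix M *ᵥ X.vec = (X - M * X * Mᵀ).vec := by
  rw [steinMatrix, Matrix.sub_mulVec, Matrix.one_mulVec, Matrix.kronecker_mulVec_vec,
    Matrix.vec_sub]

theorem det_steinMatrix_ne_zero {n : ℕ} {M : Matrix (Fin n) (Fin n) ℝ} (hM : specRad M < 1) :
    (steinMatrix M).det ≠ 0 := by
  intro hdet
  obtain ⟨v, hv, hv0⟩ := Matrix.exists_mulVec_eq_zero_iff.2 hdet
  obtain ⟨X, rfl⟩ := Matrix.vec_bijective.2 v
  rw [steinMatrix_mulVec_vec, Matrix.vec_eq_zero_iff] at hv0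
  have hX : M * X * Mᵀ = X := (sub_eq_zero.1 hv0).symm
  have hpow : ∀ t : ℕ, M ^ t * X * Mᵀ ^ t = X := by
    intro t
    induction t with
    | zero => simp
    | succ t ih =>
      calc M ^ (t + 1) * X * Mᵀ ^ (t + 1) = M ^ t * (M * X * Mᵀ) * Mᵀ ^ t := by
            rw [pow_succ, pow_succ']; simp only [mul_assoc]
        _ = X := by rw [hX, ih]
  have h := (summable_lyapunov hM X).tendsto_atTop_zero
  simp only [hpow] at h
  exact hv (Matrix.vec_eq_zero_iff.2 (tendsto_nhds_unique tendsto_const_nhds h))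

theorem vec_tsum_lyapunov {n : ℕ} {M : Matrix (Fin n) (Fin n) ℝ} (hM : specRad M < 1)
    (B : Matrix (Fin n) (Fin n) ℝ) :
    (∑' t : ℕ, M ^ t * B * Mᵀ ^ t).vec =
      ((steinMatrix M).det⁻¹ • (steinMatrix M).adjugate) *ᵥ B.vec := by
  have hs := summable_lyapunov hM B
  have hfix : (∑' t : ℕ, M ^ t * B * Mᵀ ^ t) - M * (∑' t : ℕ, M ^ t * B * Mᵀ ^ t) * Mᵀ = B := by
    rw [sub_eq_iff_eq_add, ← hs.tsum_mul_left, ← (hs.mul_left M).tsum_mul_right]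
    conv_lhs => rw [hs.tsum_eq_zero_add]
    simp only [pow_zero, one_mul, mul_one]
    congr 2
    ext1 t
    rw [pow_succ', pow_succ]
    simp only [mul_assoc]
  conv_rhs => rw [← hfix, ← steinMatrix_mulVec_vec, Matrix.mulVec_mulVec, Matrix.smul_mul,
    Matrix.adjugate_mul, smul_smul, inv_mul_cancel₀ (det_steinMatrix_ne_zero hM), one_smul,
    Matrix.one_mulVec]

section Analytic

variable {E : Type*} [NormedAddCommGroup E] [NormedSpace ℝ E] {x : E}

theorem analyticAt_matrix_mul_apply {l m n : Type*} [Fintype m] {f : E → Matrix l m ℝ}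
    {g : E → Matrix m n ℝ} (hf : ∀ i j, AnalyticAt ℝ (fun y ↦ f y i j) x)
    (hg : ∀ i j, AnalyticAt ℝ (fun y ↦ g y i j) x) (i : l) (j : n) :
    AnalyticAt ℝ (fun y ↦ (f y * g y) i j) x := by
  simp only [Matrix.mul_apply]
  exact Finset.analyticAt_fun_sum _ fun k _ ↦ (hf i k).mul (hg k j)

theorem analyticAt_matrix_det {m : Type*} [Fintype m] [DecidableEq m] {f : E → Matrix m m ℝ}
    (hf : ∀ i j, AnalyticAt ℝ (fun y ↦ f y i j) x) : AnalyticAt ℝ (fun y ↦ (f y).det) x := by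
  simp only [Matrix.det_apply']
  exact Finset.analyticAt_fun_sum _ fun σ _ ↦
    analyticAt_const.mul (Finset.analyticAt_fun_prod _ fun i _ ↦ hf _ _)

theorem analyticAt_matrix_adjugate_apply {m : Type*} [Fintype m] [DecidableEq m]
    {f : E → Matrix m m ℝ} (hf : ∀ i j, AnalyticAt ℝ (fun y ↦ f y i j) x) (i j : m) :
    AnalyticAt ℝ (fun y ↦ (f y).adjugate i j) x := by
  simp only [Matrix.adjugate_apply]
  refine analyticAt_matrix_det fun k l ↦ ?_
  simp only [Matrix.updateRow_apply]
  split_ifs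
  · exact analyticAt_const
  · exact hf k l

theorem analyticAt_steinMatrix_apply {n : ℕ} {f : E → Matrix (Fin n) (Fin n) ℝ}
    (hf : ∀ i j, AnalyticAt ℝ (fun y ↦ f y i j) x) (i j : Fin n × Fin n) :
    AnalyticAt ℝ (fun y ↦ steinMatrix (f y) i j) x := by
  simp only [steinMatrix, Matrix.sub_apply, Matrix.kroneckerMap_apply]
  exact analyticAt_const.sub ((hf _ _).mul (hf _ _))

end Analytic

theorem analyticAt_matrix_apply {n m : ℕ} (L : Matrix (Fin n) (Fin m) ℝ) (i : Fin n)
    (j : Fin m) : AnalyticAt ℝ (fun L : Matrix (Fin n) (Fin m) ℝ ↦ L i j) L :=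
  (Matrix.entryLinearMap ℝ ℝ i j).toContinuousLinearMap.analyticAt L

theorem stmt_0 {n m : ℕ} (hn : 0 < n) (hm : 0 < m)
    (A : Matrix (Fin n) (Fin n) ℝ) (H : Matrix (Fin m) (Fin n) ℝ)
    (Q : Matrix (Fin n) (Fin n) ℝ) (R : Matrix (Fin m) (Fin m) ℝ)
    (hQ : Q.PosDef) (hR : R.PosDef)
    (S : Set (Matrix (Fin n) (Fin m) ℝ))
    (hS : S = {L | specRad (A - L * H) < 1})
    (X : Matrix (Fin n) (Fin m) ℝ → Matrix (Fin n) (Fin n) ℝ)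
    (hX : ∀ L, X L = ∑' t : ℕ, (A - L * H) ^ t * (Q + L * R * Lᵀ) * ((A - L * H)ᵀ) ^ t)
    (J : Matrix (Fin n) (Fin m) ℝ → ℝ)
    (hJ : ∀ L, J L = Matrix.trace (X L * Hᵀ * H) + Matrix.trace R) :
    IsOpen S ∧ AnalyticOn ℝ J S := by
  subst hS
  have hcl : Continuous fun L : Matrix (Fin n) (Fin m) ℝ ↦ A - L * H := by fun_prop
  refine ⟨(isOpen_setOf_specRad_lt_one n).preimage hcl, ?_⟩
  have hXL : ∀ L : Matrix (Fin n) (Fin m) ℝ, specRad (A - L * H) < 1 → ∀ i j, X L i j =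
      (((steinMatrix (A - L * H)).det⁻¹ • (steinMatrix (A - L * H)).adjugate) *ᵥ
        (Q + L * R * Lᵀ).vec) (j, i) := fun L hL i j ↦ by
    rw [← vec_tsum_lyapunov hL, ← hX]
    rfl
  have hJL : ∀ L, J L = ∑ i, ∑ j, X L i j * (Hᵀ * H) j i + Matrix.trace R := fun L ↦ by
    rw [hJ, Matrix.mul_assoc]
    simp only [Matrix.trace, Matrix.diag_apply, Matrix.mul_apply]
  suffices h : AnalyticOn ℝ (fun L : Matrix (Fin n) (Fin m) ℝ ↦ ∑ i, ∑ j,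
      (((steinMatrix (A - L * H)).det⁻¹ • (steinMatrix (A - L * H)).adjugate) *ᵥ
        (Q + L * R * Lᵀ).vec) (j, i) * (Hᵀ * H) j i + Matrix.trace R)
      {L : Matrix (Fin n) (Fin m) ℝ | specRad (A - L * H) < 1} by
    refine h.congr fun L hL ↦ ?_
    simp only [hJL, hXL L hL]
  intro L hL
  refine AnalyticAt.analyticWithinAt ?_
  have hid := analyticAt_matrix_apply L
  have hA : ∀ i j, AnalyticAt ℝ (fun L : Matrix (Fin n) (Fin m) ℝ ↦ (A - L * H) i j) L :=
    fun i j ↦ analyticAt_const.sub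
      (analyticAt_matrix_mul_apply (g := fun _ ↦ H) hid (fun _ _ ↦ analyticAt_const) i j)
  have hB : ∀ i j, AnalyticAt ℝ (fun L : Matrix (Fin n) (Fin m) ℝ ↦ (Q + L * R * Lᵀ) i j) L :=
    fun i j ↦ analyticAt_const.add (analyticAt_matrix_mul_apply
      (analyticAt_matrix_mul_apply (g := fun _ ↦ R) hid fun _ _ ↦ analyticAt_const)
      (fun i j ↦ hid j i) i j)
  have hK := analyticAt_steinMatrix_apply hA
  have hdet := (analyticAt_matrix_det hK).inv (det_steinMatrix_ne_zero hL)
  refine AnalyticAt.add (Finset.analyticAt_fun_sum _ fun i _ ↦ Finset.analyticAt_fun_sum _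
    fun j _ ↦ AnalyticAt.mul ?_ analyticAt_const) analyticAt_const
  exact Finset.analyticAt_fun_sum _ fun k _ ↦
    (hdet.mul (analyticAt_matrix_adjugate_apply hK _ _)).mul (hB _ _)
end

section
/- Suppose the pair (A, H) is observable. Then J blows up at the boundary of S: if (L_k) is a sequence in S converging to a matrix L∞ with ρ(A − L∞·H) = 1, then J(L_k) → ∞. -/
open Matrix Filter Topology

section FactorizationOfPosDef

open scoped MatrixOrder Matrix.Norms.L2Operator

theorem Matrix.PosDef.exists_isUnit_eq_transpose_mul_self {n : ℕ}
    {Q : Matrix (Fin n) (Fin n) ℝ} (hQ : Q.PosDef) :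
    ∃ C : Matrix (Fin n) (Fin n) ℝ, IsUnit C ∧ Q = Cᵀ * C := by
  obtain ⟨C, hC, h⟩ := CStarAlgebra.isStrictlyPositive_iff_eq_star_mul_self.mp
    hQ.isStrictlyPositive
  exact ⟨C, hC, by rw [h, star_eq_conjTranspose, conjTranspose_eq_transpose_of_trivial]⟩

end FactorizationOfPosDef

section ObservedSeries

open scoped Matrix.Norms.Frobenius

theorem trace_mul_transpose_self_eq_sq_frobenius_norm {m n : ℕ}
    (B : Matrix (Fin m) (Fin n) ℝ) : (B * Bᵀ).trace = ‖B‖ ^ 2 := by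
  rw [frobenius_norm_def, ← Real.sqrt_eq_rpow, Real.sq_sqrt (by positivity)]
  simp [Matrix.trace, Matrix.mul_apply, sq]

theorem frobenius_norm_map_ofReal {m n : ℕ} (B : Matrix (Fin m) (Fin n) ℝ) :
    ‖B.map Complex.ofReal‖ = ‖B‖ :=
  frobenius_norm_map_eq B _ fun a => Complex.norm_real a

theorem map_ofReal_mul {l m n : ℕ} (B : Matrix (Fin l) (Fin m) ℝ)
    (C : Matrix (Fin m) (Fin n) ℝ) :
    (B * C).map Complex.ofReal = B.map Complex.ofReal * C.map Complex.ofReal :=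
  Matrix.map_mul (f := Complex.ofRealHom)

theorem map_ofReal_pow {n : ℕ} (M : Matrix (Fin n) (Fin n) ℝ) (t : ℕ) :
    (M ^ t).map Complex.ofReal = M.map Complex.ofReal ^ t :=
  Matrix.map_pow M Complex.ofRealHom t

/-- Powers of a Schur-stable matrix decay geometrically. -/
theorem exists_norm_pow_le_of_specRad_lt_one {n : ℕ} {M : Matrix (Fin n) (Fin n) ℝ}
    (hM : specRad M < 1) :
    ∃ r : ℝ, 0 ≤ r ∧ r < 1 ∧ ∀ᶠ t : ℕ in atTop, ‖M ^ t‖ ≤ r ^ t := by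
  obtain ⟨r, hr, hr1⟩ := ENNReal.lt_iff_exists_nnreal_btwn.mp hM
  have h := spectrum.pow_nnnorm_pow_one_div_tendsto_nhds_spectralRadius
    (M.map Complex.ofReal)
  refine ⟨r, r.2, by exact_mod_cast hr1, ?_⟩
  filter_upwards [h.eventually_lt_const hr, eventually_gt_atTop 0] with t ht ht0
  rw [one_div, ENNReal.rpow_inv_lt_iff (by exact_mod_cast ht0), ENNReal.rpow_natCast] at ht
  rw [← frobenius_norm_map_ofReal, map_ofReal_pow]
  exact_mod_cast ht.le

theorem summable_lyapunov_series {n : ℕ} {M : Matrix (Fin n) (Fin n) ℝ}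
    (hM : specRad M < 1) (P : Matrix (Fin n) (Fin n) ℝ) :
    Summable fun t : ℕ => M ^ t * P * Mᵀ ^ t := by
  obtain ⟨r, hr0, hr1, hr⟩ := exists_norm_pow_le_of_specRad_lt_one hM
  have hg : Summable fun t : ℕ => ‖P‖ * (r ^ 2) ^ t :=
    (summable_geometric_of_lt_one (by positivity) (by nlinarith)).mul_left _
  refine hg.of_norm_bounded_eventually_nat ?_
  filter_upwards [hr] with t ht
  calc ‖M ^ t * P * Mᵀ ^ t‖ ≤ ‖M ^ t‖ * ‖P‖ * ‖Mᵀ ^ t‖ :=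
        (norm_mul_le _ _).trans (by gcongr; exact norm_mul_le _ _)
    _ = ‖P‖ * (‖M ^ t‖ * ‖M ^ t‖) := by
        rw [← transpose_pow, frobenius_norm_transpose]; ring
    _ ≤ ‖P‖ * (r ^ t * r ^ t) := by gcongr
    _ = ‖P‖ * (r ^ 2) ^ t := by ring

theorem trace_mul_transpose_mul_eq {m n : ℕ} (H : Matrix (Fin m) (Fin n) ℝ)
    (M P : Matrix (Fin n) (Fin n) ℝ) (t : ℕ) :
    (M ^ t * P * Mᵀ ^ t * Hᵀ * H).trace = (H * M ^ t * P * (H * M ^ t)ᵀ).trace := by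
  rw [trace_mul_comm, transpose_mul, transpose_pow]
  simp only [Matrix.mul_assoc]

/-- The cost of a stabilizing gain dominates every partial sum of the observed series in which
the noise covariance is replaced by a smaller one. -/
theorem sum_trace_le_trace_tsum {m n : ℕ} (H : Matrix (Fin m) (Fin n) ℝ)
    {M : Matrix (Fin n) (Fin n) ℝ} (hM : specRad M < 1) {Q W : Matrix (Fin n) (Fin n) ℝ}
    (hQ : Q.PosSemidef) (hW : W.PosSemidef) (N : ℕ) :
    ∑ t ∈ Finset.range N, (H * M ^ t * Q * (H * M ^ t)ᵀ).trace ≤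
      ((∑' t : ℕ, M ^ t * (Q + W) * Mᵀ ^ t) * Hᵀ * H).trace := by
  have hnonneg : ∀ {P : Matrix (Fin n) (Fin n) ℝ}, P.PosSemidef → ∀ t : ℕ,
      0 ≤ (H * M ^ t * P * (H * M ^ t)ᵀ).trace := fun hP t => by
    simpa only [conjTranspose_eq_transpose_of_trivial] using
      (hP.mul_mul_conjTranspose_same (H * M ^ t)).trace_nonneg
  have hsum : HasSum (fun t : ℕ => (H * M ^ t * (Q + W) * (H * M ^ t)ᵀ).trace)
      ((∑' t : ℕ, M ^ t * (Q + W) * Mᵀ ^ t) * Hᵀ * H).trace := by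
    have hcont : Continuous fun Y : Matrix (Fin n) (Fin n) ℝ => (Y * Hᵀ * H).trace := by
      fun_prop
    let φ : Matrix (Fin n) (Fin n) ℝ →+ ℝ :=
      { toFun := fun Y => (Y * Hᵀ * H).trace
        map_zero' := by simp
        map_add' := fun Y Z => by simp [Matrix.add_mul] }
    simpa only [Function.comp_def, φ, AddMonoidHom.coe_mk, ZeroHom.coe_mk,
      trace_mul_transpose_mul_eq] using
      (summable_lyapunov_series hM (Q + W)).hasSum.map φ hcont
  refine le_trans (Finset.sum_le_sum fun t _ => ?_)
    (sum_le_hasSum (Finset.range N) (fun t _ => hnonneg (hQ.add hW) t) hsum)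
  rw [Matrix.mul_add, Matrix.add_mul, trace_add]
  exact le_add_of_nonneg_right (hnonneg hW t)

theorem re_comp_map_ofReal_mulVec {m n : ℕ} (B : Matrix (Fin m) (Fin n) ℝ) (v : Fin n → ℂ) :
    (fun i => (B.map Complex.ofReal *ᵥ v) i |>.re) = B *ᵥ fun i => (v i).re := by
  ext i
  simp [Matrix.mulVec, dotProduct]

theorem im_comp_map_ofReal_mulVec {m n : ℕ} (B : Matrix (Fin m) (Fin n) ℝ) (v : Fin n → ℂ) :
    (fun i => (B.map Complex.ofReal *ᵥ v) i |>.im) = B *ᵥ fun i => (v i).im := by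
  ext i
  simp [Matrix.mulVec, dotProduct]

theorem pow_mulVec_of_mulVec_eq_smul {n : ℕ} {M : Matrix (Fin n) (Fin n) ℂ} {v : Fin n → ℂ}
    {μ : ℂ} (h : M *ᵥ v = μ • v) (t : ℕ) : M ^ t *ᵥ v = μ ^ t • v := by
  induction t with
  | zero => simp
  | succ t ih => rw [pow_succ, ← mulVec_mulVec, h, mulVec_smul, ih, smul_smul, pow_succ']

/-- An observable pair remains observable after output injection: no eigenvector of `A - L * H`
is annihilated by `H`. -/
theorem mulVec_ne_zero_of_observable {m n : ℕ} {A : Matrix (Fin n) (Fin n) ℝ}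
    {H : Matrix (Fin m) (Fin n) ℝ}
    (hObs : ∀ v : Fin n → ℝ,
      (∀ t : ℕ, t ≤ n - 1 → H.mulVec ((A ^ t).mulVec v) = 0) → v = 0)
    (L : Matrix (Fin n) (Fin m) ℝ) {v : Fin n → ℂ} (hv : v ≠ 0) {μ : ℂ}
    (h : (A - L * H).map Complex.ofReal *ᵥ v = μ • v) : H.map Complex.ofReal *ᵥ v ≠ 0 := by
  intro hH
  have hA : A.map Complex.ofReal *ᵥ v = μ • v := by
    have hdecomp : A.map Complex.ofReal =
        (A - L * H).map Complex.ofReal + L.map Complex.ofReal * H.map Complex.ofReal := by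
      rw [← map_ofReal_mul]; ext i j; simp
    rw [hdecomp, add_mulVec, h, ← mulVec_mulVec, hH, mulVec_zero, add_zero]
  have hzero : ∀ t : ℕ, (H * A ^ t).map Complex.ofReal *ᵥ v = 0 := fun t => by
    rw [map_ofReal_mul, map_ofReal_pow, ← mulVec_mulVec, pow_mulVec_of_mulVec_eq_smul hA,
      mulVec_smul, hH, smul_zero]
  have hre := hObs (fun i => (v i).re) fun t _ => by
    rw [mulVec_mulVec, ← re_comp_map_ofReal_mulVec, hzero]; rfl
  have him := hObs (fun i => (v i).im) fun t _ => by
    rw [mulVec_mulVec, ← im_comp_map_ofReal_mulVec, hzero]; rfl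
  exact hv (funext fun i => Complex.ext (congrFun hre i) (congrFun him i))

theorem exists_eigenvector_of_specRad_eq_one {n : ℕ} (hn : 0 < n)
    {M : Matrix (Fin n) (Fin n) ℝ} (hM : specRad M = 1) :
    ∃ (μ : ℂ) (v : Fin n → ℂ), ‖μ‖ = 1 ∧ v ≠ 0 ∧ M.map Complex.ofReal *ᵥ v = μ • v := by
  have : Nonempty (Fin n) := ⟨⟨0, hn⟩⟩
  obtain ⟨μ, hμ, hnorm⟩ := spectrum.exists_nnnorm_eq_spectralRadius (M.map Complex.ofReal)
  have hnorm' : (‖μ‖₊ : ENNReal) = 1 := hnorm.trans hM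
  rw [spectrum.mem_iff, isUnit_iff_isUnit_det, isUnit_iff_ne_zero, not_not] at hμ
  obtain ⟨v, hv, h⟩ := exists_mulVec_eq_zero_iff.mpr hμ
  refine ⟨μ, v, congrArg NNReal.toReal (ENNReal.coe_eq_one.mp hnorm'), hv, ?_⟩
  rw [sub_mulVec, sub_eq_zero, Algebra.algebraMap_eq_smul_one, smul_mulVec, one_mulVec] at h
  exact h.symm

/-- A mode on the unit circle that is seen by `H` contributes a uniformly positive amount to
every term of the observed series. -/
theorem exists_pos_le_trace_of_eigenvector {m n : ℕ} {H : Matrix (Fin m) (Fin n) ℝ}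
    {M Q : Matrix (Fin n) (Fin n) ℝ} (hQ : Q.PosDef) {μ : ℂ} (hμ : ‖μ‖ = 1) {v : Fin n → ℂ}
    (h : M.map Complex.ofReal *ᵥ v = μ • v) (hH : H.map Complex.ofReal *ᵥ v ≠ 0) :
    ∃ δ : ℝ, 0 < δ ∧ ∀ t : ℕ, δ ≤ (H * M ^ t * Q * (H * M ^ t)ᵀ).trace := by
  obtain ⟨C, hC, rfl⟩ := hQ.exists_isUnit_eq_transpose_mul_self
  have hCdet : IsUnit Cᵀ.det := by rw [det_transpose]; exact (isUnit_iff_isUnit_det C).mp hC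
  set w := Cᵀ⁻¹.map Complex.ofReal *ᵥ v with hw
  have hCw : Cᵀ.map Complex.ofReal *ᵥ w = v := by
    rw [hw, mulVec_mulVec, ← map_ofReal_mul, mul_nonsing_inv _ hCdet,
      Matrix.map_one _ Complex.ofReal_zero Complex.ofReal_one, one_mulVec]
  set a := ‖replicateCol Unit (H.map Complex.ofReal *ᵥ v)‖
  set b := ‖replicateCol Unit w‖ with hb
  have ha0 : 0 < a := norm_pos_iff.mpr fun h0 => hH <| funext fun i => congrFun (congrFun h0 i) ()
  have hbound : ∀ t : ℕ, a ≤ ‖H * M ^ t * Cᵀ‖ * b := fun t => by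
    have hmode : (H * M ^ t * Cᵀ).map Complex.ofReal *ᵥ w =
        μ ^ t • (H.map Complex.ofReal *ᵥ v) := by
      rw [map_ofReal_mul, ← mulVec_mulVec, hCw, map_ofReal_mul, map_ofReal_pow, ← mulVec_mulVec,
        pow_mulVec_of_mulVec_eq_smul h, mulVec_smul]
    calc a = ‖replicateCol Unit (μ ^ t • (H.map Complex.ofReal *ᵥ v))‖ := by
          rw [replicateCol_smul, norm_smul, norm_pow, hμ, one_pow, one_mul]
      _ = ‖(H * M ^ t * Cᵀ).map Complex.ofReal * replicateCol Unit w‖ := by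
          rw [← hmode, replicateCol_mulVec]
      _ ≤ ‖H * M ^ t * Cᵀ‖ * b := by
          rw [← frobenius_norm_map_ofReal]; exact frobenius_norm_mul _ _
  have hb0 : 0 < b := (norm_nonneg _).lt_of_ne' fun h0 => by
    have := hbound 0
    rw [hb, h0, mul_zero] at this
    exact this.not_gt ha0
  refine ⟨(a / b) ^ 2, by positivity, fun t => ?_⟩
  have htrace : (H * M ^ t * (Cᵀ * C) * (H * M ^ t)ᵀ).trace = ‖H * M ^ t * Cᵀ‖ ^ 2 := by
    rw [← trace_mul_transpose_self_eq_sq_frobenius_norm, transpose_mul _ Cᵀ, transpose_transpose]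
    simp only [Matrix.mul_assoc]
  rw [htrace]
  gcongr
  exact (div_le_iff₀ hb0).mpr (hbound t)

end ObservedSeries

theorem stmt_2 {n m : ℕ} (hn : 0 < n) (hm : 0 < m)
    (A : Matrix (Fin n) (Fin n) ℝ) (H : Matrix (Fin m) (Fin n) ℝ)
    (Q : Matrix (Fin n) (Fin n) ℝ) (R : Matrix (Fin m) (Fin m) ℝ)
    (hQ : Q.PosDef) (hR : R.PosDef)
    (hObs : ∀ v : Fin n → ℝ,
      (∀ t : ℕ, t ≤ n - 1 → H.mulVec ((A ^ t).mulVec v) = 0) → v = 0)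
    (S : Set (Matrix (Fin n) (Fin m) ℝ))
    (hS : S = {L | specRad (A - L * H) < 1})
    (X : Matrix (Fin n) (Fin m) ℝ → Matrix (Fin n) (Fin n) ℝ)
    (hX : ∀ L, X L = ∑' t : ℕ, (A - L * H) ^ t * (Q + L * R * Lᵀ) * ((A - L * H)ᵀ) ^ t)
    (J : Matrix (Fin n) (Fin m) ℝ → ℝ)
    (hJ : ∀ L, J L = Matrix.trace (X L * Hᵀ * H) + Matrix.trace R)
    (Lk : ℕ → Matrix (Fin n) (Fin m) ℝ) (hLk : ∀ k, Lk k ∈ S)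
    (Linf : Matrix (Fin n) (Fin m) ℝ)
    (hconv : Tendsto Lk atTop (nhds Linf))
    (hbd : specRad (A - Linf * H) = 1) :
    Tendsto (fun k => J (Lk k)) atTop atTop := by
  obtain ⟨μ, v, hμ, hv, hMv⟩ := exists_eigenvector_of_specRad_eq_one hn hbd
  obtain ⟨δ, hδ, hle⟩ := exists_pos_le_trace_of_eigenvector hQ hμ hMv
    (mulVec_ne_zero_of_observable hObs Linf hv hMv)
  let g : ℕ → Matrix (Fin n) (Fin m) ℝ → ℝ := fun N L =>
    ∑ t ∈ Finset.range N, (H * (A - L * H) ^ t * Q * (H * (A - L * H) ^ t)ᵀ).trace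
  have hg : ∀ N, Continuous (g N) := fun N => by fun_prop
  refine tendsto_atTop.mpr fun c => ?_
  obtain ⟨N, hN⟩ := exists_nat_gt ((c - R.trace) / δ)
  have hlim : c - R.trace < g N Linf :=
    calc c - R.trace < N * δ := (div_lt_iff₀ hδ).mp hN
      _ = ∑ t ∈ Finset.range N, δ := by simp
      _ ≤ g N Linf := Finset.sum_le_sum fun t _ => hle t
  filter_upwards [(((hg N).tendsto Linf).comp hconv).eventually_const_lt hlim] with k hk
  have hstable : specRad (A - Lk k * H) < 1 := by simpa [hS] using hLk k
  have hW : (Lk k * R * (Lk k)ᵀ).PosSemidef := by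
    simpa only [conjTranspose_eq_transpose_of_trivial] using
      hR.posSemidef.mul_mul_conjTranspose_same (Lk k)
  have hJk : g N (Lk k) ≤ (X (Lk k) * Hᵀ * H).trace := by
    rw [hX]
    exact sum_trace_le_trace_tsum H hstable hQ.posSemidef hW N
  rw [hJ]
  have : c - R.trace < g N (Lk k) := hk
  linarith
end

section
/- Suppose the pair (A, H) is observable and S is nonempty. Then there exists a unique L* ∈ S such that J(L*) ≤ J(L) for all L ∈ S, and this minimizer satisfies L* = A · X(L*) · Hᵀ · (R + H · X(L*) · Hᵀ)⁻¹ (equivalently, L* · R = A_{L*} · X(L*) · Hᵀ, i.e., G(L*) = 0). -/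
open Matrix Filter Topology

namespace SchurStable

section FrobeniusNorm

attribute [local instance] Matrix.frobeniusNormedRing Matrix.frobeniusNormedAlgebra

/-- Powers of a Schur-stable matrix decay geometrically in the Frobenius norm. -/
theorem eventually_norm_pow_le {n : ℕ} {M : Matrix (Fin n) (Fin n) ℝ} (hM : specRad M < 1) :
    ∃ r : ℝ, 0 ≤ r ∧ r < 1 ∧ ∀ᶠ t : ℕ in atTop, ‖M ^ t‖ ≤ r ^ t := by
  obtain ⟨r, hr, hr1⟩ := ENNReal.lt_iff_exists_nnreal_btwn.mp hM
  refine ⟨r, r.2, by exact_mod_cast hr1, ?_⟩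
  have h := (spectrum.pow_nnnorm_pow_one_div_tendsto_nhds_spectralRadius
    (M.map Complex.ofReal)).eventually_lt_const hr
  filter_upwards [h, eventually_gt_atTop 0] with t ht htpos
  have hmap : M.map Complex.ofReal ^ t = (M ^ t).map Complex.ofReal :=
    (map_pow (Complex.ofRealHom.mapMatrix) M t).symm
  have hnorm : ‖(M ^ t).map Complex.ofReal‖₊ = ‖M ^ t‖₊ :=
    frobenius_nnnorm_map_eq _ _ fun a => by simp
  rw [hmap, hnorm] at ht
  have h2 : (‖M ^ t‖₊ : ENNReal) ≤ (r : ENNReal) ^ t := by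
    have := ENNReal.rpow_le_rpow ht.le (z := (t : ℝ)) (by positivity)
    rwa [← ENNReal.rpow_mul, one_div, inv_mul_cancel₀ (by positivity), ENNReal.rpow_one,
      ENNReal.rpow_natCast] at this
  exact_mod_cast h2

/-- The Lyapunov series of a Schur-stable matrix converges. -/
theorem summable_lyapunov {n : ℕ} {M : Matrix (Fin n) (Fin n) ℝ} (hM : specRad M < 1)
    (W : Matrix (Fin n) (Fin n) ℝ) : Summable fun t : ℕ => M ^ t * W * Mᵀ ^ t := by
  obtain ⟨r, hr0, hr1, h⟩ := eventually_norm_pow_le hM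
  have hs : Summable fun t : ℕ => ‖W‖ * (r * r) ^ t :=
    (summable_geometric_of_lt_one (by positivity) (by nlinarith)).mul_left _
  refine Summable.of_norm_bounded_eventually_nat hs ?_
  filter_upwards [h] with t ht
  have hT : ‖Mᵀ ^ t‖ ≤ r ^ t := by rwa [← transpose_pow, frobenius_norm_transpose]
  calc ‖M ^ t * W * Mᵀ ^ t‖ ≤ ‖M ^ t‖ * ‖W‖ * ‖Mᵀ ^ t‖ := norm_mul₃_le
    _ ≤ r ^ t * ‖W‖ * r ^ t := by gcongr
    _ = ‖W‖ * (r * r) ^ t := by rw [mul_pow]; ring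

end FrobeniusNorm

/-- A solution of the Lyapunov equation of a Schur-stable matrix is the sum of the Lyapunov
series. -/
theorem hasSum_of_lyapunov {n : ℕ} {M : Matrix (Fin n) (Fin n) ℝ} (hM : specRad M < 1)
    {D W : Matrix (Fin n) (Fin n) ℝ} (hD : D = M * D * Mᵀ + W) :
    HasSum (fun t : ℕ => M ^ t * W * Mᵀ ^ t) D := by
  have hpart : ∀ t : ℕ, ∑ i ∈ Finset.range t, M ^ i * W * Mᵀ ^ i = D - M ^ t * D * Mᵀ ^ t := by
    intro t
    induction t with
    | zero => simp
    | succ t ih =>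
      have hW : W = D - M * D * Mᵀ := eq_sub_of_add_eq' hD.symm
      rw [Finset.sum_range_succ, ih, pow_succ M, pow_succ' Mᵀ, hW]
      noncomm_ring
  refine (summable_lyapunov hM W).hasSum_iff_tendsto_nat.2 ?_
  simp only [hpart]
  simpa using tendsto_const_nhds.sub (summable_lyapunov hM D).tendsto_atTop_zero

/-- The sum of the Lyapunov series of a Schur-stable matrix solves the Lyapunov equation. -/
theorem tsum_lyapunov {n : ℕ} {M : Matrix (Fin n) (Fin n) ℝ} (hM : specRad M < 1)
    (W : Matrix (Fin n) (Fin n) ℝ) :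
    ∑' t : ℕ, M ^ t * W * Mᵀ ^ t = M * (∑' t : ℕ, M ^ t * W * Mᵀ ^ t) * Mᵀ + W := by
  have hs := summable_lyapunov hM W
  conv_lhs => rw [hs.tsum_eq_zero_add]
  rw [← hs.tsum_mul_left, ← (hs.mul_left M).tsum_mul_right, add_comm]
  simp only [pow_zero, one_mul, mul_one]
  congr 2
  funext t
  rw [pow_succ' M, pow_succ Mᵀ]
  noncomm_ring

theorem isClosed_posSemidef {n : ℕ} : IsClosed {X : Matrix (Fin n) (Fin n) ℝ | X.PosSemidef} := by
  simp only [posSemidef_iff_dotProduct_mulVec, IsHermitian, Set.ofPred_and, Set.ofPred_forall]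
  refine (isClosed_eq (by fun_prop) continuous_id).inter (isClosed_iInter fun x => ?_)
  exact isClosed_le continuous_const
    (continuous_const.dotProduct (continuous_id.matrix_mulVec continuous_const))

theorem posSemidef_mul_mul_transpose {m n : ℕ} {P : Matrix (Fin n) (Fin n) ℝ}
    (hP : P.PosSemidef) (B : Matrix (Fin m) (Fin n) ℝ) : (B * P * Bᵀ).PosSemidef := by
  simpa using hP.mul_mul_conjTranspose_same B

/-- A solution of a Lyapunov equation with positive semidefinite forcing is positive
semidefinite. -/
theorem posSemidef_of_lyapunov {n : ℕ} {M : Matrix (Fin n) (Fin n) ℝ} (hM : specRad M < 1)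
    {D W : Matrix (Fin n) (Fin n) ℝ} (hW : W.PosSemidef) (hD : D = M * D * Mᵀ + W) :
    D.PosSemidef := by
  refine isClosed_posSemidef.mem_of_tendsto (hasSum_of_lyapunov hM hD).tendsto_sum_nat
    (Eventually.of_forall fun t => posSemidef_sum _ fun i _ => ?_)
  rw [← transpose_pow]
  exact posSemidef_mul_mul_transpose hW _

/-- Lyapunov's criterion for Schur stability. -/
theorem specRad_lt_one_of_posDef {n : ℕ} {M P : Matrix (Fin n) (Fin n) ℝ}
    (hn : 0 < n) (hP : P.PosDef) (hMP : (P - M * P * Mᵀ).PosDef) : specRad M < 1 := by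
  have : Nonempty (Fin n) := ⟨⟨0, hn⟩⟩
  let := Matrix.frobeniusNormedRing (m := Fin n) (α := ℂ)
  let := Matrix.frobeniusNormedAlgebra (R := ℂ) (m := Fin n) (α := ℂ)
  refine spectrum.spectralRadius_lt_of_forall_lt (r := 1) _ fun k hk => ?_
  rw [mem_spectrum_iff_isRoot_charpoly, ← charpoly_transpose,
    ← mem_spectrum_iff_isRoot_charpoly, ← spectrum_toLin',
    ← Module.End.hasEigenvalue_iff_mem_spectrum] at hk
  obtain ⟨v, hv⟩ := hk.exists_hasEigenvector
  have hv0 := hv.2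
  have hve : (M.map Complex.ofReal)ᵀ *ᵥ v = k • v := by simpa using hv.apply_eq_smul
  set a : Fin n → ℝ := fun i => (v i).re with ha
  set b : Fin n → ℝ := fun i => (v i).im with hb
  have hMa : Mᵀ *ᵥ a = k.re • a - k.im • b := by
    funext i
    have := congrArg Complex.re (congrFun hve i)
    simpa [mulVec, dotProduct, ha, hb] using this
  have hMb : Mᵀ *ᵥ b = k.im • a + k.re • b := by
    funext i
    have := congrArg Complex.im (congrFun hve i)
    simpa [mulVec, dotProduct, ha, hb, add_comm] using this
  have hq : ∀ x : Fin n → ℝ, x ⬝ᵥ ((P - M * P * Mᵀ) *ᵥ x) =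
      x ⬝ᵥ (P *ᵥ x) - (Mᵀ *ᵥ x) ⬝ᵥ (P *ᵥ (Mᵀ *ᵥ x)) := by
    intro x
    rw [sub_mulVec, dotProduct_sub, ← mulVec_mulVec, ← mulVec_mulVec, dotProduct_mulVec x M,
      mulVec_transpose M x]
  have hab : a ≠ 0 ∨ b ≠ 0 := by
    by_contra! h
    exact hv0 (funext fun i => Complex.ext (congrFun h.1 i) (congrFun h.2 i))
  have hpos : ∀ {N : Matrix (Fin n) (Fin n) ℝ}, N.PosDef →
      0 < a ⬝ᵥ (N *ᵥ a) + b ⬝ᵥ (N *ᵥ b) := by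
    intro N hN
    have h1 : ∀ x, 0 ≤ x ⬝ᵥ (N *ᵥ x) := by simpa using hN.posSemidef.dotProduct_mulVec_nonneg
    rcases hab with h | h
    · have := hN.dotProduct_mulVec_pos h
      simp only [star_trivial] at this
      linarith [h1 b]
    · have := hN.dotProduct_mulVec_pos h
      simp only [star_trivial] at this
      linarith [h1 a]
  have h1 := hpos hP
  have h2 := hpos hMP
  rw [hq, hq, hMa, hMb] at h2
  have hexp : (k.re • a - k.im • b) ⬝ᵥ (P *ᵥ (k.re • a - k.im • b)) +
      (k.im • a + k.re • b) ⬝ᵥ (P *ᵥ (k.im • a + k.re • b)) =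
      Complex.normSq k * (a ⬝ᵥ (P *ᵥ a) + b ⬝ᵥ (P *ᵥ b)) := by
    simp only [mulVec_sub, mulVec_add, mulVec_smul, dotProduct_sub, dotProduct_add,
      sub_dotProduct, add_dotProduct, smul_dotProduct, dotProduct_smul, smul_eq_mul,
      Complex.normSq_apply]
    ring
  have h3 : Complex.normSq k < 1 := by
    by_contra! h
    nlinarith
  rw [Complex.normSq_eq_norm_sq, sq_lt_one_iff₀ (norm_nonneg k)] at h3
  exact_mod_cast h3

section Riccati

variable {n m : ℕ} (A : Matrix (Fin n) (Fin n) ℝ) (H : Matrix (Fin m) (Fin n) ℝ)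
  (Q : Matrix (Fin n) (Fin n) ℝ) (R : Matrix (Fin m) (Fin m) ℝ)

/-- One step of the error covariance recursion with gain `L`. -/
def covStep (L : Matrix (Fin n) (Fin m) ℝ) (X : Matrix (Fin n) (Fin n) ℝ) :
    Matrix (Fin n) (Fin n) ℝ :=
  (A - L * H) * X * (A - L * H)ᵀ + (Q + L * R * Lᵀ)

/-- The Kalman gain associated with the covariance `X`. -/
noncomputable def kalmanGain (X : Matrix (Fin n) (Fin n) ℝ) : Matrix (Fin n) (Fin m) ℝ :=
  A * X * Hᵀ * (R + H * X * Hᵀ)⁻¹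

variable {A H Q R} {X : Matrix (Fin n) (Fin n) ℝ}

theorem posDef_innovation (hR : R.PosDef) (hX : X.PosSemidef) : (R + H * X * Hᵀ).PosDef :=
  hR.add_posSemidef (posSemidef_mul_mul_transpose hX H)

theorem kalmanGain_mul (hR : R.PosDef) (hX : X.PosSemidef) :
    kalmanGain A H R X * (R + H * X * Hᵀ) = A * X * Hᵀ := by
  rw [kalmanGain, Matrix.mul_assoc, nonsing_inv_mul _
    ((isUnit_iff_isUnit_det _).1 (posDef_innovation hR hX).isUnit), Matrix.mul_one]

theorem kalmanGain_mul_noise (hR : R.PosDef) (hX : X.PosSemidef) :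
    kalmanGain A H R X * R = (A - kalmanGain A H R X * H) * X * Hᵀ := by
  have h := kalmanGain_mul (A := A) (H := H) hR hX
  rw [Matrix.sub_mul, Matrix.sub_mul, ← h, Matrix.mul_add]
  simp only [Matrix.mul_assoc]
  abel

/-- Completion of squares in the gain. -/
theorem covStep_eq (hR : R.PosDef) (hX : X.PosSemidef) (L : Matrix (Fin n) (Fin m) ℝ) :
    covStep A H Q R L X = covStep A H Q R (kalmanGain A H R X) X +
      (L - kalmanGain A H R X) * (R + H * X * Hᵀ) * (L - kalmanGain A H R X)ᵀ := by
  have hXt : Xᵀ = X := by simpa using hX.isHermitian.eq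
  have hRt : Rᵀ = R := by simpa using hR.isHermitian.eq
  have hK := kalmanGain_mul (A := A) (H := H) hR hX
  set K := kalmanGain A H R X
  have hKt : (R + H * X * Hᵀ) * Kᵀ = H * X * Aᵀ := by
    have := congrArg transpose hK
    simpa [transpose_mul, hXt, hRt, Matrix.mul_assoc] using this
  have key : ∀ L : Matrix (Fin n) (Fin m) ℝ, covStep A H Q R L X =
      A * X * Aᵀ + Q - K * (R + H * X * Hᵀ) * Kᵀ +
        (L - K) * (R + H * X * Hᵀ) * (L - K)ᵀ := by
    intro L
    have h1 : (L - K) * (R + H * X * Hᵀ) * (L - K)ᵀ =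
        L * (R + H * X * Hᵀ) * Lᵀ - A * X * Hᵀ * Lᵀ - L * (H * X * Aᵀ)
          + K * (R + H * X * Hᵀ) * Kᵀ := by
      rw [← hK, ← hKt, transpose_sub]
      simp only [Matrix.sub_mul, Matrix.mul_sub, ← Matrix.mul_assoc]
      abel
    rw [h1, covStep]
    simp only [transpose_sub, transpose_mul, Matrix.sub_mul, Matrix.mul_sub, Matrix.add_mul,
      Matrix.mul_add, ← Matrix.mul_assoc]
    abel
  rw [key L, key K]
  simp

/-- A supersolution of the Riccati equation has a stabilizing Kalman gain. -/
theorem specRad_kalmanGain_lt_one (hn : 0 < n) (hQ : Q.PosDef) (hR : R.PosDef) (hX : X.PosSemidef)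
    (hsup : (X - covStep A H Q R (kalmanGain A H R X) X).PosSemidef) :
    specRad (A - kalmanGain A H R X * H) < 1 := by
  set K := kalmanGain A H R X
  have hdiff : (X - (A - K * H) * X * (A - K * H)ᵀ).PosDef := by
    have := (hQ.add_posSemidef (posSemidef_mul_mul_transpose hR.posSemidef K)).add_posSemidef hsup
    rwa [covStep, add_comm _ (Q + _), add_sub, add_sub_add_left_eq_sub] at this
  refine specRad_lt_one_of_posDef hn ?_ hdiff
  simpa using hdiff.add_posSemidef (posSemidef_mul_mul_transpose hX (A - K * H))

theorem continuousOn_sub_covStep_kalmanGain (hR : R.PosDef) :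
    ContinuousOn (fun X => X - covStep A H Q R (kalmanGain A H R X) X)
      {X | X.PosSemidef} := by
  have hK : ContinuousOn (fun X => kalmanGain A H R X) {X | X.PosSemidef} := by
    intro X hX
    have hdet : (R + H * X * Hᵀ).det ≠ 0 := (posDef_innovation hR hX).det_pos.ne'
    have hinv : ContinuousAt (fun X : Matrix (Fin n) (Fin n) ℝ => (R + H * X * Hᵀ)⁻¹) X := by
      refine ContinuousAt.comp (f := fun X : Matrix (Fin n) (Fin n) ℝ => R + H * X * Hᵀ)
        (continuousAt_matrix_inv _ ?_) (by fun_prop)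
      rw [Ring.inverse_eq_inv']
      exact continuousAt_inv₀ hdet
    have hpair : ContinuousAt (fun X : Matrix (Fin n) (Fin n) ℝ =>
        (A * X * Hᵀ, (R + H * X * Hᵀ)⁻¹)) X := ContinuousAt.prodMk (by fun_prop) hinv
    have hmul : Continuous fun p : Matrix (Fin n) (Fin m) ℝ × Matrix (Fin m) (Fin m) ℝ =>
        p.1 * p.2 := by fun_prop
    exact (hmul.continuousAt.comp hpair).continuousWithinAt
  have hstep : Continuous fun p : Matrix (Fin n) (Fin m) ℝ × Matrix (Fin n) (Fin n) ℝ =>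
      p.2 - covStep A H Q R p.1 p.2 := by
    unfold covStep
    fun_prop
  exact hstep.comp_continuousOn (hK.prodMk continuousOn_id)

theorem abs_apply_le_trace (hX : X.PosSemidef) (i j : Fin n) : |X i j| ≤ X.trace := by
  have hsym : X j i = X i j := by simpa using hX.isHermitian.apply i j
  have hdiag : ∀ k, X k k ≤ X.trace := fun k =>
    Finset.single_le_sum (f := fun k => X k k) (fun k _ => hX.diag_nonneg) (Finset.mem_univ k)
  have hp := hX.dotProduct_mulVec_nonneg (Pi.single i 1 + Pi.single j 1)
  have hm := hX.dotProduct_mulVec_nonneg (Pi.single i 1 - Pi.single j 1)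
  simp only [star_trivial, mulVec_add, mulVec_sub, dotProduct_add, dotProduct_sub, add_dotProduct,
    sub_dotProduct, mulVec_single_one, single_one_dotProduct, col_apply, hsym] at hp hm
  have := hdiag i
  have := hdiag j
  rw [abs_le]
  constructor <;> linarith

/-- The set of positive semidefinite supersolutions of the Riccati equation with bounded trace is
compact. -/
theorem isCompact_supersolutions (hR : R.PosDef) (c : ℝ) :
    IsCompact {X : Matrix (Fin n) (Fin n) ℝ | X.PosSemidef ∧
      (X - covStep A H Q R (kalmanGain A H R X) X).PosSemidef ∧ X.trace ≤ c} := by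
  have hbox : IsCompact (Set.univ.pi fun _ => Set.univ.pi fun _ => Set.Icc (-c) c :
      Set (Matrix (Fin n) (Fin n) ℝ)) :=
    isCompact_univ_pi fun _ => isCompact_univ_pi fun _ => isCompact_Icc
  refine hbox.of_isClosed_subset ?_ ?_
  · have h1 := (continuousOn_sub_covStep_kalmanGain (A := A) (H := H) (Q := Q)
      hR).preimage_isClosed_of_isClosed isClosed_posSemidef isClosed_posSemidef
    have h2 : IsClosed {X : Matrix (Fin n) (Fin n) ℝ | X.trace ≤ c} :=
      isClosed_le continuous_id.matrix_trace continuous_const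
    have h3 := h1.inter h2
    rw [Set.inter_assoc] at h3
    exact h3
  · rintro X ⟨hX, -, hc⟩ i - j -
    exact abs_le.1 ((abs_apply_le_trace hX i j).trans hc)

/-- The algebraic Riccati equation has a stabilizing solution. -/
theorem exists_stabilizing_riccati_solution (hn : 0 < n) (hQ : Q.PosDef) (hR : R.PosDef)
    (hS : ∃ L : Matrix (Fin n) (Fin m) ℝ, specRad (A - L * H) < 1) :
    ∃ X : Matrix (Fin n) (Fin n) ℝ, X.PosSemidef ∧ specRad (A - kalmanGain A H R X * H) < 1 ∧
      X = covStep A H Q R (kalmanGain A H R X) X := by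
  have hW : ∀ L : Matrix (Fin n) (Fin m) ℝ, (Q + L * R * Lᵀ).PosSemidef := fun L =>
    hQ.posSemidef.add (posSemidef_mul_mul_transpose hR.posSemidef L)
  have hsuper : ∀ {L : Matrix (Fin n) (Fin m) ℝ} {X : Matrix (Fin n) (Fin n) ℝ}, X.PosSemidef →
      X = covStep A H Q R L X →
      (X - covStep A H Q R (kalmanGain A H R X) X).PosSemidef := by
    intro L X hX hL
    rw [covStep_eq hR hX] at hL
    rw [sub_eq_of_eq_add' hL]
    exact posSemidef_mul_mul_transpose (posDef_innovation hR hX).posSemidef _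
  obtain ⟨L₀, hL₀⟩ := hS
  obtain ⟨X₀, hX₀⟩ : ∃ X₀, X₀ = covStep A H Q R L₀ X₀ := ⟨_, tsum_lyapunov hL₀ (Q + L₀ * R * L₀ᵀ)⟩
  have hX₀p := posSemidef_of_lyapunov hL₀ (hW L₀) hX₀
  obtain ⟨X, ⟨hX, hsup, hc⟩, hmin⟩ := (isCompact_supersolutions hR X₀.trace).exists_isMinOn
    ⟨X₀, hX₀p, hsuper hX₀p hX₀, le_rfl⟩ continuous_id.matrix_trace.continuousOn
  have hK := specRad_kalmanGain_lt_one hn hQ hR hX hsup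
  refine ⟨X, hX, hK, ?_⟩
  set K := kalmanGain A H R X
  obtain ⟨X', hX'⟩ : ∃ X', X' = covStep A H Q R K X' := ⟨_, tsum_lyapunov hK (Q + K * R * Kᵀ)⟩
  have hX'p := posSemidef_of_lyapunov hK (hW K) hX'
  have hle : (X - X').PosSemidef := by
    refine posSemidef_of_lyapunov hK hsup ?_
    conv_lhs => rw [hX']
    simp only [covStep]
    noncomm_ring
  have htr := hle.trace_nonneg
  rw [trace_sub] at htr
  have h1 : X.trace ≤ X'.trace := hmin ⟨hX'p, hsuper hX'p hX', by simp only [id] at *; linarith⟩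
  have h2 : X - X' = 0 := hle.trace_eq_zero_iff.1 (by rw [trace_sub]; linarith)
  rwa [← sub_eq_zero.1 h2] at hX'

theorem eq_zero_of_mul_mul_transpose_eq_zero {k : ℕ} {N : Matrix (Fin m) (Fin m) ℝ} (hN : N.PosDef)
    {B : Matrix (Fin k) (Fin m) ℝ} (h : B * N * Bᵀ = 0) : B = 0 := by
  ext i j
  by_contra hij
  have hrow : B.row i ≠ 0 := fun h0 => hij (congrFun h0 j)
  have hpos := hN.dotProduct_mulVec_pos hrow
  have hii : (B * N * Bᵀ) i i = B.row i ⬝ᵥ (N *ᵥ B.row i) := by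
    rw [Matrix.mul_assoc]
    simp [mul_apply, mulVec, dotProduct, row]
  rw [h] at hii
  simp [← hii] at hpos

/-- Observability forces a gain perturbation that is invisible in the output covariance to
vanish. -/
theorem eq_zero_of_output_eq_zero (hObs : ∀ v : Fin n → ℝ,
      (∀ t : ℕ, t ≤ n - 1 → H.mulVec ((A ^ t).mulVec v) = 0) → v = 0)
    {L : Matrix (Fin n) (Fin m) ℝ} {D : Matrix (Fin n) (Fin n) ℝ} {B : Matrix (Fin n) (Fin m) ℝ}
    {N : Matrix (Fin m) (Fin m) ℝ} (hN : N.PosDef) (hD : D.PosSemidef)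
    (hlyap : D = (A - L * H) * D * (A - L * H)ᵀ + B * N * Bᵀ) (h0 : H * D * Hᵀ = 0) : B = 0 := by
  have hsplit : ∀ Z : Matrix (Fin m) (Fin n) ℝ, Z * D * Zᵀ = 0 →
      Z * (A - L * H) * D * (Z * (A - L * H))ᵀ = 0 ∧ Z * B = 0 := by
    intro Z hZ
    have h1 := posSemidef_mul_mul_transpose hD (Z * (A - L * H))
    have h2 := posSemidef_mul_mul_transpose hN.posSemidef (Z * B)
    have hsum : Z * (A - L * H) * D * (Z * (A - L * H))ᵀ + Z * B * N * (Z * B)ᵀ = 0 := by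
      rw [← hZ]
      conv_rhs => rw [hlyap]
      simp only [transpose_mul, Matrix.mul_add, Matrix.add_mul, Matrix.mul_assoc]
    have htr := congrArg trace hsum
    rw [trace_add, trace_zero] at htr
    refine ⟨h1.trace_eq_zero_iff.1 ?_, eq_zero_of_mul_mul_transpose_eq_zero hN
      (h2.trace_eq_zero_iff.1 ?_)⟩ <;> linarith [h1.trace_nonneg, h2.trace_nonneg]
  have hZ : ∀ t : ℕ, H * (A - L * H) ^ t * D * (H * (A - L * H) ^ t)ᵀ = 0 := by
    intro t
    induction t with
    | zero => simpa using h0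
    | succ t ih => rw [pow_succ, ← Matrix.mul_assoc]; exact (hsplit _ ih).1
  have hpow : ∀ t : ℕ, A ^ t * B = (A - L * H) ^ t * B := by
    intro t
    induction t with
    | zero => simp
    | succ t ih =>
      have h := (hsplit _ (hZ t)).2
      rw [pow_succ', pow_succ' (A - L * H), Matrix.mul_assoc, ih, Matrix.mul_assoc (A - L * H),
        Matrix.sub_mul, Matrix.mul_assoc L H, ← Matrix.mul_assoc H, h]
      simp
  have hHB : ∀ t : ℕ, H * (A ^ t * B) = 0 := fun t => by
    rw [hpow, ← Matrix.mul_assoc]; exact (hsplit _ (hZ t)).2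
  ext i j
  refine congrFun (hObs (B.col j) fun t _ => ?_) i
  rw [← mulVec_single_one, mulVec_mulVec, mulVec_mulVec, Matrix.mul_assoc, hHB, zero_mulVec]

end Riccati

end SchurStable

open SchurStable

theorem stmt_6 {n m : ℕ} (hn : 0 < n) (hm : 0 < m)
    (A : Matrix (Fin n) (Fin n) ℝ) (H : Matrix (Fin m) (Fin n) ℝ)
    (Q : Matrix (Fin n) (Fin n) ℝ) (R : Matrix (Fin m) (Fin m) ℝ)
    (hQ : Q.PosDef) (hR : R.PosDef)
    (hObs : ∀ v : Fin n → ℝ,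
      (∀ t : ℕ, t ≤ n - 1 → H.mulVec ((A ^ t).mulVec v) = 0) → v = 0)
    (S : Set (Matrix (Fin n) (Fin m) ℝ))
    (hS : S = {L | specRad (A - L * H) < 1})
    (hSne : S.Nonempty)
    (X : Matrix (Fin n) (Fin m) ℝ → Matrix (Fin n) (Fin n) ℝ)
    (hX : ∀ L, X L = ∑' t : ℕ, (A - L * H) ^ t * (Q + L * R * Lᵀ) * ((A - L * H)ᵀ) ^ t)
    (Y : Matrix (Fin n) (Fin m) ℝ → Matrix (Fin n) (Fin n) ℝ)
    (hY : ∀ L, Y L = ∑' t : ℕ, ((A - L * H)ᵀ) ^ t * (Hᵀ * H) * (A - L * H) ^ t)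
    (J : Matrix (Fin n) (Fin m) ℝ → ℝ)
    (hJ : ∀ L, J L = Matrix.trace (X L * Hᵀ * H) + Matrix.trace R)
    (G : Matrix (Fin n) (Fin m) ℝ → Matrix (Fin n) (Fin m) ℝ)
    (hG : ∀ L, G L = (2 : ℝ) • (Y L * (-(L * R) + (A - L * H) * X L * Hᵀ))) :
    ∃ Lstar ∈ S, (∀ L ∈ S, J Lstar ≤ J L) ∧
      (∀ L' ∈ S, (∀ L ∈ S, J L' ≤ J L) → L' = Lstar) ∧
      Lstar = A * X Lstar * Hᵀ * (R + H * X Lstar * Hᵀ)⁻¹ ∧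
      Lstar * R = (A - Lstar * H) * X Lstar * Hᵀ ∧
      G Lstar = 0 := by
  subst hS
  have hWp : ∀ L : Matrix (Fin n) (Fin m) ℝ, (Q + L * R * Lᵀ).PosSemidef := fun L =>
    hQ.posSemidef.add (posSemidef_mul_mul_transpose hR.posSemidef L)
  have hXeq : ∀ L, specRad (A - L * H) < 1 → X L = covStep A H Q R L (X L) := fun L hL => by
    rw [hX]
    exact tsum_lyapunov hL _
  obtain ⟨P, hP, hK, hric⟩ := exists_stabilizing_riccati_solution hn hQ hR hSne
  set K := kalmanGain A H R P with hKdef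
  have hXK : X K = P := by
    rw [hX]
    exact (hasSum_of_lyapunov hK hric).tsum_eq
  have hN := posDef_innovation (H := H) hR hP
  have hdiff : ∀ L, specRad (A - L * H) < 1 → X L - P =
      (A - L * H) * (X L - P) * (A - L * H)ᵀ + (L - K) * (R + H * P * Hᵀ) * (L - K)ᵀ := by
    intro L hL
    have h1 := covStep_eq (A := A) (H := H) (Q := Q) hR hP L
    rw [← hKdef, ← hric] at h1
    rw [← sub_eq_of_eq_add' h1]
    conv_lhs => rw [hXeq L hL]
    simp only [covStep]
    noncomm_ring
  have hpsd : ∀ L, specRad (A - L * H) < 1 → (X L - P).PosSemidef := fun L hL =>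
    posSemidef_of_lyapunov hL (posSemidef_mul_mul_transpose hN.posSemidef _) (hdiff L hL)
  have hJdiff : ∀ L, J L - J K = (H * (X L - P) * Hᵀ).trace := by
    intro L
    rw [hJ, hJ, hXK, Matrix.mul_assoc H, trace_mul_comm H, Matrix.sub_mul, Matrix.sub_mul,
      trace_sub]
    ring
  have hopt : ∀ L, specRad (A - L * H) < 1 → J K ≤ J L := fun L hL => by
    have h := (posSemidef_mul_mul_transpose (hpsd L hL) H).trace_nonneg
    rw [← hJdiff] at h
    linarith
  have hKR : K * R = (A - K * H) * P * Hᵀ := kalmanGain_mul_noise hR hP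
  refine ⟨K, hK, hopt, fun L hL hLmin => ?_, ?_, ?_, ?_⟩
  · have h0 : J L - J K = 0 := by linarith [hLmin K hK, hopt L hL]
    rw [hJdiff, (posSemidef_mul_mul_transpose (hpsd L hL) H).trace_eq_zero_iff] at h0
    exact sub_eq_zero.1 (eq_zero_of_output_eq_zero hObs hN (hpsd L hL) (hdiff L hL) h0)
  · rw [hXK, hKdef, kalmanGain]
  · rw [hXK, hKR]
  · rw [hG, hXK, hKR]
    simp
end

section
/- Suppose the pair (A, H) is observable, S is nonempty, and let L* be the unique minimizer of J over S. Then for every α > 0 with S_α nonempty there exist constants c₁ > 0 and c₂ > 0 (depending only on α and the problem data, not on L) such that for every L ∈ S_α: c₁·(J(L) − J(L*)) + c₂·‖L − L*‖_F² ≤ ‖G(L)‖_F². -/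
open Matrix Filter Topology

/-- Frobenius norm of a real matrix. -/
noncomputable def frobNorm {k l : ℕ} (M : Matrix (Fin k) (Fin l) ℝ) : ℝ :=
  Real.sqrt (Matrix.trace (Mᵀ * M))

section Loewner

open scoped MatrixOrder

variable {ι κ : Type*} [Fintype ι] [Fintype κ]

theorem posSemidef_transpose_mul_mul {P : Matrix ι ι ℝ} (hP : P.PosSemidef) (M : Matrix ι κ ℝ) :
    (Mᵀ * P * M).PosSemidef := by
  simpa using hP.conjTranspose_mul_mul_same M

theorem posSemidef_mul_mul_transpose {P : Matrix ι ι ℝ} (hP : P.PosSemidef) (M : Matrix κ ι ℝ) :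
    (M * P * Mᵀ).PosSemidef := by
  simpa using hP.mul_mul_conjTranspose_same M

theorem trace_transpose_mul_self_nonneg (M : Matrix κ ι ℝ) : 0 ≤ (Mᵀ * M).trace := by
  simpa using (posSemidef_conjTranspose_mul_self M).trace_nonneg

theorem transpose_mul_mul_mono {P P' : Matrix ι ι ℝ} (h : P ≤ P') (M : Matrix ι κ ℝ) :
    Mᵀ * P * M ≤ Mᵀ * P' * M := by
  have := posSemidef_transpose_mul_mul h M
  rwa [Matrix.mul_sub, Matrix.sub_mul] at this

theorem mul_mul_transpose_mono {P P' : Matrix ι ι ℝ} (h : P ≤ P') (M : Matrix κ ι ℝ) :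
    M * P * Mᵀ ≤ M * P' * Mᵀ := by
  simpa using transpose_mul_mul_mono h Mᵀ

variable [DecidableEq ι]

theorem exists_eq_transpose_mul_self {P : Matrix ι ι ℝ} (hP : P.PosSemidef) :
    ∃ B : Matrix ι ι ℝ, P = Bᵀ * B := by
  obtain ⟨B, hB⟩ := CStarAlgebra.nonneg_iff_eq_star_mul_self.mp hP.nonneg
  exact ⟨B, by simpa [star_eq_conjTranspose] using hB⟩

theorem trace_mul_nonneg_of_posSemidef {P N : Matrix ι ι ℝ} (hP : P.PosSemidef)
    (hN : N.PosSemidef) : 0 ≤ (P * N).trace := by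
  obtain ⟨B, rfl⟩ := exists_eq_transpose_mul_self hP
  have h := (posSemidef_mul_mul_transpose hN B).trace_nonneg
  rwa [trace_mul_comm, ← Matrix.mul_assoc] at h

theorem trace_mul_le_trace_mul_left {P P' N : Matrix ι ι ℝ} (hP : P ≤ P') (hN : N.PosSemidef) :
    (P * N).trace ≤ (P' * N).trace := by
  have h := trace_mul_nonneg_of_posSemidef hP hN
  rwa [Matrix.sub_mul, trace_sub, sub_nonneg] at h

theorem trace_mul_le_trace_mul_right {P N N' : Matrix ι ι ℝ} (hP : P.PosSemidef) (hN : N ≤ N') :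
    (P * N).trace ≤ (P * N').trace := by
  rw [trace_mul_comm P, trace_mul_comm P]
  exact trace_mul_le_trace_mul_left hN hP

theorem le_trace_smul_one {P : Matrix ι ι ℝ} (hP : P.PosSemidef) : P ≤ P.trace • 1 := by
  refine PosSemidef.of_dotProduct_mulVec_nonneg
    ((isHermitian_one.smul (IsSelfAdjoint.all _)).sub hP.isHermitian) fun x => ?_
  obtain ⟨B, rfl⟩ := exists_eq_transpose_mul_self hP
  have h1 : x ⬝ᵥ (Bᵀ * B) *ᵥ x = ∑ i, (∑ j, B i j * x j) ^ 2 := by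
    rw [← mulVec_mulVec, dotProduct_mulVec, vecMul_transpose]
    simp [dotProduct, mulVec, sq]
  have h2 : (Bᵀ * B).trace = ∑ i, ∑ j, B i j ^ 2 := by
    rw [trace_mul_comm]
    simp [trace, mul_apply, sq]
  have h3 : x ⬝ᵥ x = ∑ j, x j ^ 2 := by simp [dotProduct, sq]
  simp only [star_trivial, Matrix.sub_mulVec, smul_mulVec, one_mulVec, dotProduct_sub,
    dotProduct_smul, h1, h2, h3, smul_eq_mul, sub_nonneg]
  rw [Finset.sum_mul]
  exact Finset.sum_le_sum fun i _ => Finset.sum_mul_sq_le_sq_mul_sq _ _ _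

theorem exists_pos_smul_one_le {P : Matrix ι ι ℝ} (hP : P.PosDef) :
    ∃ r : ℝ, 0 < r ∧ r • (1 : Matrix ι ι ℝ) ≤ P := by
  obtain ⟨C, hC⟩ := exists_eq_transpose_mul_self hP.inv.posSemidef
  have hCC : (C * Cᵀ).PosSemidef := by simpa using posSemidef_self_mul_conjTranspose C
  have htr := hCC.trace_nonneg
  set r : ℝ := (1 + (C * Cᵀ).trace)⁻¹ with hr
  have hr0 : 0 < r := by positivity
  refine ⟨r, hr0, ?_⟩
  have h1 : (1 - r • (C * Cᵀ)).PosSemidef := by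
    have h2 := ((le_trace_smul_one hCC).smul hr0.le).add
      (PosSemidef.one.smul hr0.le : (r • (1 : Matrix ι ι ℝ)).PosSemidef)
    have h3 : r * (C * Cᵀ).trace + r = 1 := by rw [hr]; field_simp; ring
    rwa [smul_sub, smul_smul, sub_add_eq_add_sub, ← add_smul, h3, one_smul] at h2
  have h2 := posSemidef_transpose_mul_mul (posSemidef_transpose_mul_mul h1 C) P
  have hPt : Pᵀ = P := by simpa using hP.isHermitian.eq
  have hu := (isUnit_iff_isUnit_det _).mp hP.isUnit
  have h3 : P * (Cᵀ * C) = 1 := by rw [← hC, mul_nonsing_inv _ hu]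
  have h4 : (Cᵀ * C) * P = 1 := by rw [← hC, nonsing_inv_mul _ hu]
  have h5 : Pᵀ * (Cᵀ * (1 - r • (C * Cᵀ)) * C) * P = P - r • 1 := by
    calc Pᵀ * (Cᵀ * (1 - r • (C * Cᵀ)) * C) * P
        = (P * (Cᵀ * C)) * P - r • ((P * (Cᵀ * C)) * ((Cᵀ * C) * P)) := by
          rw [hPt]
          simp only [Matrix.mul_sub, Matrix.sub_mul, Matrix.mul_smul, Matrix.smul_mul,
            Matrix.mul_one, Matrix.mul_assoc]
      _ = P - r • 1 := by rw [h3, h4, Matrix.one_mul, Matrix.one_mul]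
  rwa [h5] at h2

end Loewner

section Lyapunov

section Summability

open scoped Matrix.Norms.Frobenius

theorem summable_pow_mul_mul_transpose_pow {n : ℕ} {B : Matrix (Fin n) (Fin n) ℝ}
    (hB : specRad B < 1) (W : Matrix (Fin n) (Fin n) ℝ) :
    (Summable fun t : ℕ => B ^ t * W * Bᵀ ^ t) ∧ Summable fun t : ℕ => Bᵀ ^ t * W * B ^ t := by
  obtain ⟨q, hρq, hq1⟩ := ENNReal.lt_iff_exists_nnreal_btwn.mp hB
  have hnorm : ∀ t : ℕ, ‖(B.map Complex.ofReal) ^ t‖₊ = ‖B ^ t‖₊ := fun t => by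
    have : (B.map Complex.ofReal) ^ t = (B ^ t).map Complex.ofReal :=
      (map_pow (Complex.ofRealHom.mapMatrix) B t).symm
    rw [this]
    exact frobenius_nnnorm_map_eq _ _ fun a => by simp
  have hev : ∀ᶠ t : ℕ in atTop, ‖B ^ t‖ ≤ (q : ℝ) ^ t := by
    filter_upwards [(spectrum.pow_nnnorm_pow_one_div_tendsto_nhds_spectralRadius
      (B.map Complex.ofReal)).eventually_lt_const hρq, eventually_gt_atTop 0] with t ht ht0
    rw [hnorm] at ht
    have h1 := pow_le_pow_left' ht.le t
    rw [← ENNReal.rpow_natCast, ← ENNReal.rpow_mul, one_div,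
      inv_mul_cancel₀ (by positivity), ENNReal.rpow_one] at h1
    exact_mod_cast h1
  have hq1' : q < 1 := by exact_mod_cast hq1
  have hgeo : Summable fun t : ℕ => ((q : ℝ) ^ t) * ‖W‖ * (q : ℝ) ^ t := by
    have : (fun t : ℕ => ((q : ℝ) ^ t) * ‖W‖ * (q : ℝ) ^ t) = fun t => ‖W‖ * ((q : ℝ) * q) ^ t := by
      ext t; rw [mul_pow]; ring
    rw [this]
    refine (summable_geometric_of_lt_one (by positivity) ?_).mul_left _
    exact_mod_cast mul_lt_one_of_nonneg_of_lt_one_left zero_le hq1' hq1'.le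
  constructor
  all_goals
    refine Summable.of_norm_bounded_eventually_nat hgeo ?_
    filter_upwards [hev] with t ht
    have ht' : ‖Bᵀ ^ t‖ ≤ (q : ℝ) ^ t := by
      rw [← transpose_pow, frobenius_norm_transpose]; exact ht
    refine (frobenius_norm_mul _ _).trans ?_
    gcongr
    exact (frobenius_norm_mul _ _).trans (by gcongr)

end Summability

variable {n : ℕ}

theorem tsum_pow_mul_mul_pow_eq {B C W : Matrix (Fin n) (Fin n) ℝ}
    (hs : Summable fun t : ℕ => B ^ t * W * C ^ t) :
    ∑' t : ℕ, B ^ t * W * C ^ t = B * (∑' t : ℕ, B ^ t * W * C ^ t) * C + W := by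
  conv_lhs => rw [hs.tsum_eq_zero_add]
  rw [← hs.tsum_mul_left, ← (hs.mul_left B).tsum_mul_right]
  simp only [pow_zero, one_mul, mul_one]
  rw [add_comm]
  congr 2
  ext1 t
  rw [pow_succ', pow_succ]
  simp only [mul_assoc]

theorem posSemidef_tsum {f : ℕ → Matrix (Fin n) (Fin n) ℝ} (hs : Summable f)
    (hf : ∀ t, (f t).PosSemidef) : (∑' t, f t).PosSemidef := by
  refine PosSemidef.of_dotProduct_mulVec_nonneg ?_ fun x => ?_
  · have h : (∑' t, f t)ᵀ = ∑' t, f t := by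
      rw [Matrix.transpose_tsum]
      exact tsum_congr fun t => by simpa using (hf t).isHermitian.eq
    simpa [IsHermitian] using h
  · have hc : Continuous fun M : Matrix (Fin n) (Fin n) ℝ => star x ⬝ᵥ M *ᵥ x := by fun_prop
    have h := hs.hasSum.map (AddMonoidHom.mk' (fun M : Matrix (Fin n) (Fin n) ℝ => star x ⬝ᵥ M *ᵥ x)
      fun M N => by rw [Matrix.add_mulVec, dotProduct_add]) hc
    exact h.nonneg fun t => (hf t).dotProduct_mulVec_nonneg x

theorem transpose_pow_mul_mul_pow_posSemidef {W : Matrix (Fin n) (Fin n) ℝ} (hW : W.PosSemidef)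
    (B : Matrix (Fin n) (Fin n) ℝ) (t : ℕ) : (Bᵀ ^ t * W * B ^ t).PosSemidef := by
  rw [← transpose_pow]
  exact posSemidef_transpose_mul_mul hW _

theorem pow_mul_mul_transpose_pow_posSemidef {W : Matrix (Fin n) (Fin n) ℝ} (hW : W.PosSemidef)
    (B : Matrix (Fin n) (Fin n) ℝ) (t : ℕ) : (B ^ t * W * Bᵀ ^ t).PosSemidef := by
  simpa using transpose_pow_mul_mul_pow_posSemidef hW Bᵀ t

theorem trace_mul_eq_of_lyapunov {B X Y V W : Matrix (Fin n) (Fin n) ℝ}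
    (hX : X = B * X * Bᵀ + W) (hY : Y = Bᵀ * Y * B + V) : (X * V).trace = (Y * W).trace := by
  have hV : V = Y - Bᵀ * Y * B := eq_sub_of_add_eq' hY.symm
  have hW : W = X - B * X * Bᵀ := eq_sub_of_add_eq' hX.symm
  rw [hV, hW, Matrix.mul_sub, Matrix.mul_sub, trace_sub, trace_sub, trace_mul_comm X Y]
  congr 1
  rw [trace_mul_comm Y, ← Matrix.mul_assoc, ← Matrix.mul_assoc, trace_mul_comm _ B]
  simp only [Matrix.mul_assoc]

theorem specRad_lt_one_of_lyapunov (hn : 0 < n) {B X : Matrix (Fin n) (Fin n) ℝ}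
    (hX : X.PosDef) (hBX : (X - B * X * Bᵀ).PosDef) : specRad B < 1 := by
  have : NeZero n := ⟨hn.ne'⟩
  let _ := Matrix.frobeniusNormedRing (m := Fin n) (α := ℂ)
  let _ := Matrix.frobeniusNormedAlgebra (m := Fin n) (R := ℂ) (α := ℂ)
  rw [specRad, ← ENNReal.coe_one]
  refine spectrum.spectralRadius_lt_of_forall_lt _ fun z hz => ?_
  rw [spectrum.mem_iff, isUnit_iff_isUnit_det, isUnit_iff_ne_zero, not_not,
    ← exists_vecMul_eq_zero_iff] at hz
  obtain ⟨v, hv0, hv⟩ := hz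
  rw [Matrix.vecMul_sub, sub_eq_zero, Algebra.algebraMap_eq_smul_one, vecMul_smul, vecMul_one] at hv
  set a : Fin n → ℝ := fun i => (v i).re with ha
  set b : Fin n → ℝ := fun i => (v i).im with hb
  have hBa : Bᵀ *ᵥ a = z.re • a - z.im • b := by
    ext i
    have h := congrArg Complex.re (congrFun hv i)
    simp only [vecMul, dotProduct, Pi.smul_apply, smul_eq_mul, Complex.mul_re, Complex.re_sum,
      map_apply, Complex.ofReal_re, Complex.ofReal_im, mul_zero, sub_zero] at h
    simp [mulVec, dotProduct, ha, hb, h, mul_comm]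
  have hBb : Bᵀ *ᵥ b = z.im • a + z.re • b := by
    ext i
    have h := congrArg Complex.im (congrFun hv i)
    simp only [vecMul, dotProduct, Pi.smul_apply, smul_eq_mul, Complex.mul_im, Complex.im_sum,
      map_apply, Complex.ofReal_re, Complex.ofReal_im, mul_zero, zero_add] at h
    simp [mulVec, dotProduct, ha, hb, h, mul_comm, add_comm]
  have hXt : Xᵀ = X := by simpa using hX.isHermitian.eq
  have hsymm : a ⬝ᵥ X *ᵥ b = b ⬝ᵥ X *ᵥ a := by
    rw [dotProduct_mulVec, ← mulVec_transpose, hXt, dotProduct_comm]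
  have hquad : ∀ x : Fin n → ℝ,
      x ⬝ᵥ (B * X * Bᵀ) *ᵥ x = (Bᵀ *ᵥ x) ⬝ᵥ X *ᵥ (Bᵀ *ᵥ x) := fun x => by
    rw [← mulVec_mulVec, ← mulVec_mulVec, dotProduct_mulVec, ← mulVec_transpose]
  have hab : a ≠ 0 ∨ b ≠ 0 := by
    by_contra! h
    exact hv0 (funext fun i => Complex.ext (congrFun h.1 i) (congrFun h.2 i))
  have hpos : ∀ {P : Matrix (Fin n) (Fin n) ℝ}, P.PosDef → 0 < a ⬝ᵥ P *ᵥ a + b ⬝ᵥ P *ᵥ b := by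
    intro P hP
    have h1 : 0 ≤ a ⬝ᵥ P *ᵥ a := by simpa using hP.posSemidef.dotProduct_mulVec_nonneg a
    have h2 : 0 ≤ b ⬝ᵥ P *ᵥ b := by simpa using hP.posSemidef.dotProduct_mulVec_nonneg b
    rcases hab with h | h
    · have : 0 < a ⬝ᵥ P *ᵥ a := by simpa using hP.dotProduct_mulVec_pos h
      linarith
    · have : 0 < b ⬝ᵥ P *ᵥ b := by simpa using hP.dotProduct_mulVec_pos h
      linarith
  have h1 := hpos hX
  have h2 := hpos hBX
  simp only [Matrix.sub_mulVec, dotProduct_sub, hquad, hBa, hBb, mulVec_sub, mulVec_add, mulVec_smul,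
    sub_dotProduct, add_dotProduct, smul_dotProduct, dotProduct_smul, dotProduct_add,
    smul_eq_mul, hsymm] at h2
  have h3 : ‖z‖ ^ 2 < 1 := by
    rw [Complex.sq_norm, Complex.normSq_apply]
    by_contra! h
    nlinarith
  have h4 : ‖z‖ < 1 := by nlinarith [norm_nonneg z]
  exact_mod_cast h4

end Lyapunov

section Riccati

open scoped MatrixOrder

variable {n m : ℕ} {A Q : Matrix (Fin n) (Fin n) ℝ} {H : Matrix (Fin m) (Fin n) ℝ}
  {R : Matrix (Fin m) (Fin m) ℝ}

theorem transpose_mul_mul_le_of_lyapunov {r β : ℝ} (hr : 0 < r) (hrR : r • 1 ≤ R)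
    {L : Matrix (Fin n) (Fin m) ℝ} {Y : Matrix (Fin n) (Fin n) ℝ} (hYp : Y.PosSemidef)
    (hY : Y = (A - L * H)ᵀ * Y * (A - L * H) + Hᵀ * H)
    (hβ : (Y * (L * R * Lᵀ)).trace ≤ β) :
    Aᵀ * Y * A ≤ (2 + 2 * (β / r)) • Y := by
  set K := β / r with hK
  have hP := posSemidef_transpose_mul_mul hYp L
  have htr : (Lᵀ * Y * L).trace ≤ K := by
    rw [hK, le_div_iff₀ hr]
    refine le_trans ?_ hβ
    have h := trace_mul_le_trace_mul_right hP hrR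
    rw [Matrix.mul_smul, Matrix.mul_one, trace_smul, smul_eq_mul] at h
    rw [mul_comm]
    refine h.trans_eq ?_
    rw [← Matrix.mul_assoc, trace_mul_comm _ Lᵀ]
    simp only [Matrix.mul_assoc]
  have hK0 : 0 ≤ K := hP.trace_nonneg.trans htr
  have h1 : (K • 1 - Lᵀ * Y * L).PosSemidef := by
    have := (le_trace_smul_one hP).add
      (PosSemidef.one.smul (sub_nonneg.mpr htr) : (_ • (1 : Matrix (Fin m) (Fin m) ℝ)).PosSemidef)
    refine (congrArg PosSemidef ?_).mp this
    rw [sub_smul]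
    abel
  have hHH : (Hᵀ * H).PosSemidef := by simpa using posSemidef_conjTranspose_mul_self H
  set B := A - L * H with hB
  have hA : A = B + L * H := by rw [hB, sub_add_cancel]
  have h2 := (((posSemidef_transpose_mul_mul hYp (B - L * H)).add
    (hHH.smul (zero_le_two (α := ℝ)))).add
    ((posSemidef_transpose_mul_mul hYp B).smul (by positivity : 0 ≤ 2 * K))).add
    ((posSemidef_transpose_mul_mul h1 H).smul (zero_le_two (α := ℝ)))
  rw [Matrix.le_iff]
  refine (congrArg PosSemidef ?_).mp h2
  have h3 : (2 + 2 * K) • Y = (2 + 2 * K) • (Bᵀ * Y * B) + (2 + 2 * K) • (Hᵀ * H) := by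
    rw [← smul_add, ← hY]
  rw [h3, hA]
  simp only [transpose_add, transpose_sub, transpose_mul, Matrix.add_mul, Matrix.mul_add,
    Matrix.sub_mul, Matrix.mul_sub, Matrix.mul_smul, Matrix.smul_mul, Matrix.mul_one, Matrix.mul_assoc]
  module

theorem observability_le_smul {C : ℝ} (hC : 0 ≤ C) {Y : Matrix (Fin n) (Fin n) ℝ}
    (hAY : Aᵀ * Y * A ≤ C • Y) (hHY : Hᵀ * H ≤ Y) (t : ℕ) :
    (A ^ t)ᵀ * (Hᵀ * H) * A ^ t ≤ C ^ t • Y := by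
  refine (transpose_mul_mul_mono hHY _).trans ?_
  induction t with
  | zero => simp
  | succ t ih =>
    have h1 := (PosSemidef.smul ih hC).add (posSemidef_transpose_mul_mul hAY (A ^ t))
    rw [Matrix.le_iff]
    convert h1 using 1
    rw [pow_succ' A]
    simp only [transpose_mul, Matrix.mul_sub, Matrix.sub_mul, Matrix.mul_smul, Matrix.smul_mul,
      Matrix.mul_assoc, smul_sub, smul_smul, pow_succ' C]
    module

theorem posDef_observability (hn : 0 < n)
    (hObs : ∀ v : Fin n → ℝ, (∀ t : ℕ, t ≤ n - 1 → H.mulVec ((A ^ t).mulVec v) = 0) → v = 0) :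
    (∑ t ∈ Finset.range n, (A ^ t)ᵀ * (Hᵀ * H) * A ^ t).PosDef := by
  have hquad : ∀ (t : ℕ) (v : Fin n → ℝ),
      v ⬝ᵥ ((A ^ t)ᵀ * (Hᵀ * H) * A ^ t) *ᵥ v = (H *ᵥ A ^ t *ᵥ v) ⬝ᵥ (H *ᵥ A ^ t *ᵥ v) :=
    fun t v => by
      rw [← mulVec_mulVec, ← mulVec_mulVec, ← mulVec_mulVec, dotProduct_mulVec, vecMul_transpose,
        dotProduct_mulVec, vecMul_transpose]
  have hHH : (Hᵀ * H).PosSemidef := by simpa using posSemidef_conjTranspose_mul_self H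
  refine PosDef.of_dotProduct_mulVec_pos (posSemidef_sum _ fun t _ =>
    posSemidef_transpose_mul_mul hHH _).isHermitian fun v hv => ?_
  have hsum : star v ⬝ᵥ (∑ t ∈ Finset.range n, (A ^ t)ᵀ * (Hᵀ * H) * A ^ t) *ᵥ v =
      ∑ t ∈ Finset.range n, (H *ᵥ A ^ t *ᵥ v) ⬝ᵥ (H *ᵥ A ^ t *ᵥ v) := by
    rw [Matrix.sum_mulVec, dotProduct_sum]
    exact Finset.sum_congr rfl fun t _ => by rw [star_trivial, hquad]
  rw [hsum]
  have hnn : ∀ w : Fin m → ℝ, 0 ≤ w ⬝ᵥ w := fun w => by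
    simpa using dotProduct_star_self_nonneg w
  refine (Finset.sum_nonneg fun t _ => hnn _).lt_of_ne fun h => hv (hObs v fun t ht => ?_)
  have h0 := (Finset.sum_eq_zero_iff_of_nonneg fun t _ => hnn _).mp h.symm t
    (Finset.mem_range.mpr (by omega))
  exact dotProduct_self_eq_zero.mp h0

theorem exists_smul_one_le_gramian (hn : 0 < n) (hR : R.PosDef)
    (hObs : ∀ v : Fin n → ℝ, (∀ t : ℕ, t ≤ n - 1 → H.mulVec ((A ^ t).mulVec v) = 0) → v = 0)
    {β : ℝ} (hβ : 0 ≤ β) :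
    ∃ y : ℝ, 0 < y ∧ ∀ (L : Matrix (Fin n) (Fin m) ℝ) (Y : Matrix (Fin n) (Fin n) ℝ),
      Y.PosSemidef → Y = (A - L * H)ᵀ * Y * (A - L * H) + Hᵀ * H →
      (Y * (L * R * Lᵀ)).trace ≤ β → y • 1 ≤ Y := by
  obtain ⟨r, hr, hrR⟩ := exists_pos_smul_one_le hR
  obtain ⟨o, ho, hoO⟩ := exists_pos_smul_one_le (posDef_observability hn hObs)
  set C : ℝ := 2 + 2 * (β / r) with hC
  have hC0 : 0 < C := by positivity
  set s : ℝ := ∑ t ∈ Finset.range n, C ^ t with hs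
  have hs0 : 0 < s := Finset.sum_pos (fun t _ => by positivity) ⟨0, Finset.mem_range.mpr hn⟩
  refine ⟨s⁻¹ * o, by positivity, fun L Y hYp hY hLβ => ?_⟩
  have hAY := transpose_mul_mul_le_of_lyapunov hr hrR hYp hY hLβ
  have hHY : Hᵀ * H ≤ Y := by
    have := posSemidef_transpose_mul_mul hYp (A - L * H)
    rw [Matrix.le_iff]
    rwa [eq_sub_of_add_eq hY.symm] at this
  have h1 : (∑ t ∈ Finset.range n, (A ^ t)ᵀ * (Hᵀ * H) * A ^ t) ≤ s • Y := by
    rw [hs, Finset.sum_smul]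
    exact Finset.sum_le_sum fun t _ => observability_le_smul hC0.le hAY hHY t
  have h2 := PosSemidef.smul (hoO.trans h1) (inv_nonneg.mpr hs0.le)
  rw [Matrix.le_iff]
  rwa [smul_sub, smul_smul, smul_smul, inv_mul_cancel₀ hs0.ne', one_smul] at h2

theorem riccati_perturbation {X : Matrix (Fin n) (Fin n) ℝ} (hX : Xᵀ = X) (hR : Rᵀ = R)
    {L D E : Matrix (Fin n) (Fin m) ℝ} (hE : E = -(L * R) + (A - L * H) * X * Hᵀ) :
    (A - (L + D) * H) * X * (A - (L + D) * H)ᵀ + (Q + (L + D) * R * (L + D)ᵀ) =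
      (A - L * H) * X * (A - L * H)ᵀ + (Q + L * R * Lᵀ) +
        (D * (H * X * Hᵀ + R) * Dᵀ - E * Dᵀ - D * Eᵀ) := by
  subst hE
  simp only [transpose_add, transpose_sub, transpose_mul, transpose_neg, transpose_transpose,
    Matrix.add_mul, Matrix.mul_add, Matrix.sub_mul, Matrix.mul_sub, Matrix.neg_mul, Matrix.mul_neg,
    Matrix.mul_assoc, hX, hR]
  abel

theorem trace_sub_trace_eq {X X' Y' : Matrix (Fin n) (Fin n) ℝ} (hXt : Xᵀ = X) (hR : Rᵀ = R)
    {L D E : Matrix (Fin n) (Fin m) ℝ} (hE : E = -(L * R) + (A - L * H) * X * Hᵀ)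
    (hX : X = (A - L * H) * X * (A - L * H)ᵀ + (Q + L * R * Lᵀ))
    (hX' : X' = (A - (L + D) * H) * X' * (A - (L + D) * H)ᵀ + (Q + (L + D) * R * (L + D)ᵀ))
    (hY' : Y' = (A - (L + D) * H)ᵀ * Y' * (A - (L + D) * H) + Hᵀ * H) :
    (X' * (Hᵀ * H)).trace - (X * (Hᵀ * H)).trace =
      (Y' * (D * (H * X * Hᵀ + R) * Dᵀ - E * Dᵀ - D * Eᵀ)).trace := by
  rw [← trace_sub, ← Matrix.sub_mul]
  refine trace_mul_eq_of_lyapunov ?_ hY'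
  have h := riccati_perturbation (Q := Q) (D := D) hXt hR hE
  rw [← hX] at h
  rw [← sub_eq_of_eq_add' h, Matrix.mul_sub, Matrix.sub_mul]
  nth_rw 1 [hX']
  abel

theorem neg_trace_le_of_smul_one_le {Y : Matrix (Fin n) (Fin n) ℝ} (hY : Y.PosSemidef)
    {N : Matrix (Fin m) (Fin m) ℝ} {r : ℝ} (hr : 0 < r) (hN : r • 1 ≤ N)
    (D E : Matrix (Fin n) (Fin m) ℝ) :
    -(Y * (D * N * Dᵀ - E * Dᵀ - D * Eᵀ)).trace ≤ r⁻¹ * (Y.trace * (Eᵀ * E).trace) := by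
  have hEE : (E * Eᵀ).PosSemidef := by simpa using posSemidef_self_mul_conjTranspose E
  have hpos : (D * N * Dᵀ - E * Dᵀ - D * Eᵀ + r⁻¹ • (E * Eᵀ)).PosSemidef := by
    have hF : ((r • D - E) * (r • D - E)ᵀ).PosSemidef := by
      simpa using posSemidef_self_mul_conjTranspose (r • D - E)
    have h := (posSemidef_mul_mul_transpose hN D).add (hF.smul (inv_nonneg.mpr hr.le))
    convert h using 1
    simp only [transpose_sub, transpose_smul, Matrix.mul_sub, Matrix.sub_mul, Matrix.mul_smul,
      Matrix.smul_mul, Matrix.mul_one, smul_sub, smul_smul, inv_mul_cancel₀ hr.ne', one_smul]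
    rw [← mul_assoc, inv_mul_cancel₀ hr.ne', one_mul]
    abel
  have h1 := trace_mul_nonneg_of_posSemidef hY hpos
  rw [Matrix.mul_add, trace_add, Matrix.mul_smul, trace_smul, smul_eq_mul] at h1
  have h2 := trace_mul_le_trace_mul_left (le_trace_smul_one hY) hEE
  rw [Matrix.smul_mul, Matrix.one_mul, trace_smul, smul_eq_mul, trace_mul_comm E] at h2
  have h3 := mul_le_mul_of_nonneg_left h2 (inv_nonneg.mpr hr.le)
  linarith

theorem sq_mul_trace_le_of_smul_one_le {Y : Matrix (Fin n) (Fin n) ℝ} (hY : Y.PosSemidef) {y : ℝ}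
    (hy : 0 ≤ y) (hyY : y • 1 ≤ Y) (E : Matrix (Fin n) (Fin m) ℝ) :
    y ^ 2 * (Eᵀ * E).trace ≤ ((Y * E)ᵀ * (Y * E)).trace := by
  have hYt : Yᵀ = Y := by simpa using hY.isHermitian.eq
  have hF : ((Y - y • 1)ᵀ * (Y - y • 1)).PosSemidef := by
    rw [← conjTranspose_eq_transpose_of_trivial]
    exact posSemidef_conjTranspose_mul_self _
  have h := posSemidef_transpose_mul_mul
    (hF.add (PosSemidef.smul hyY (by positivity : 0 ≤ 2 * y))) E
  have h1 : Eᵀ * ((Y - y • 1)ᵀ * (Y - y • 1) + (2 * y) • (Y - y • 1)) * E =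
      (Y * E)ᵀ * (Y * E) - y ^ 2 • (Eᵀ * E) := by
    simp only [transpose_sub, transpose_smul, transpose_one, transpose_mul, hYt, Matrix.mul_sub,
      Matrix.sub_mul, Matrix.mul_add, Matrix.add_mul, Matrix.mul_smul, Matrix.smul_mul,
      Matrix.mul_one, Matrix.one_mul, smul_sub, smul_smul, Matrix.mul_assoc]
    module
  have h2 := h.trace_nonneg
  rw [h1, trace_sub, trace_smul, smul_eq_mul] at h2
  linarith

theorem frobNorm_sq {k l : ℕ} (M : Matrix (Fin k) (Fin l) ℝ) :
    frobNorm M ^ 2 = (Mᵀ * M).trace :=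
  Real.sq_sqrt (trace_transpose_mul_self_nonneg M)

end Riccati

open scoped MatrixOrder

theorem stmt_7 {n m : ℕ} (hn : 0 < n) (hm : 0 < m)
    (A : Matrix (Fin n) (Fin n) ℝ) (H : Matrix (Fin m) (Fin n) ℝ)
    (Q : Matrix (Fin n) (Fin n) ℝ) (R : Matrix (Fin m) (Fin m) ℝ)
    (hQ : Q.PosDef) (hR : R.PosDef)
    (hObs : ∀ v : Fin n → ℝ,
      (∀ t : ℕ, t ≤ n - 1 → H.mulVec ((A ^ t).mulVec v) = 0) → v = 0)
    (S : Set (Matrix (Fin n) (Fin m) ℝ))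
    (hS : S = {L | specRad (A - L * H) < 1})
    (hSne : S.Nonempty)
    (X : Matrix (Fin n) (Fin m) ℝ → Matrix (Fin n) (Fin n) ℝ)
    (hX : ∀ L, X L = ∑' t : ℕ, (A - L * H) ^ t * (Q + L * R * Lᵀ) * ((A - L * H)ᵀ) ^ t)
    (Y : Matrix (Fin n) (Fin m) ℝ → Matrix (Fin n) (Fin n) ℝ)
    (hY : ∀ L, Y L = ∑' t : ℕ, ((A - L * H)ᵀ) ^ t * (Hᵀ * H) * (A - L * H) ^ t)
    (J : Matrix (Fin n) (Fin m) ℝ → ℝ)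
    (hJ : ∀ L, J L = Matrix.trace (X L * Hᵀ * H) + Matrix.trace R)
    (G : Matrix (Fin n) (Fin m) ℝ → Matrix (Fin n) (Fin m) ℝ)
    (hG : ∀ L, G L = (2 : ℝ) • (Y L * (-(L * R) + (A - L * H) * X L * Hᵀ)))
    (Lstar : Matrix (Fin n) (Fin m) ℝ) (hLstarS : Lstar ∈ S)
    (hLstarMin : ∀ L ∈ S, J Lstar ≤ J L)
    (α : ℝ) (hα : 0 < α) (hαne : {L | L ∈ S ∧ J L ≤ α}.Nonempty) :
    ∃ c₁ > (0 : ℝ), ∃ c₂ > (0 : ℝ), ∀ L, L ∈ S → J L ≤ α →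
      c₁ * (J L - J Lstar) + c₂ * frobNorm (L - Lstar) ^ 2 ≤ frobNorm (G L) ^ 2 := by
  obtain ⟨r, hr, hrR⟩ := exists_pos_smul_one_le hR
  have hRt : Rᵀ = R := by simpa using hR.isHermitian.eq
  have hHH : (Hᵀ * H).PosSemidef := by simpa using posSemidef_conjTranspose_mul_self H
  have hXp : ∀ L : Matrix (Fin n) (Fin m) ℝ, (Q + L * R * Lᵀ).PosSemidef := fun L =>
    hQ.posSemidef.add (posSemidef_mul_mul_transpose hR.posSemidef L)
  have hXL : ∀ L ∈ S, X L = (A - L * H) * X L * (A - L * H)ᵀ + (Q + L * R * Lᵀ) := by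
    intro L hL
    rw [hS] at hL
    rw [hX]
    exact tsum_pow_mul_mul_pow_eq (summable_pow_mul_mul_transpose_pow hL _).1
  have hXps : ∀ L ∈ S, (X L).PosSemidef := by
    intro L hL
    rw [hS] at hL
    rw [hX]
    exact posSemidef_tsum (summable_pow_mul_mul_transpose_pow hL _).1
      (pow_mul_mul_transpose_pow_posSemidef (hXp L) _)
  have hYL : ∀ L ∈ S, Y L = (A - L * H)ᵀ * Y L * (A - L * H) + Hᵀ * H := by
    intro L hL
    rw [hS] at hL
    rw [hY]
    exact tsum_pow_mul_mul_pow_eq (summable_pow_mul_mul_transpose_pow hL _).2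
  have hYps : ∀ L ∈ S, (Y L).PosSemidef := by
    intro L hL
    rw [hS] at hL
    rw [hY]
    exact posSemidef_tsum (summable_pow_mul_mul_transpose_pow hL _).2
      (transpose_pow_mul_mul_pow_posSemidef hHH _)
  have hYJ : ∀ L ∈ S, (Y L * (L * R * Lᵀ)).trace ≤ J L := by
    intro L hL
    rw [hJ, Matrix.mul_assoc (X L), trace_mul_eq_of_lyapunov (hXL L hL) (hYL L hL), Matrix.mul_add,
      trace_add]
    have h1 := trace_mul_nonneg_of_posSemidef (hYps L hL) hQ.posSemidef
    have h2 := hR.posSemidef.trace_nonneg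
    linarith
  have hsub : ∀ L ∈ S, ∀ D, L + D ∈ S → ∀ E, E = -(L * R) + (A - L * H) * X L * Hᵀ →
      J (L + D) - J L =
        (Y (L + D) * (D * (H * X L * Hᵀ + R) * Dᵀ - E * Dᵀ - D * Eᵀ)).trace := by
    intro L hL D hD E hE
    have h := trace_sub_trace_eq (by simpa using (hXps L hL).isHermitian.eq) hRt hE (hXL L hL)
      (hXL _ hD) (hYL _ hD)
    rw [← h, hJ, hJ, Matrix.mul_assoc (X _), Matrix.mul_assoc (X _)]
    ring
  have hNr : ∀ L ∈ S, r • 1 ≤ H * X L * Hᵀ + R := fun L hL => by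
    refine hrR.trans ?_
    rw [Matrix.le_iff, add_sub_cancel_right]
    exact posSemidef_mul_mul_transpose (hXps L hL) H
  have hLstarα : J Lstar ≤ α := by
    obtain ⟨L, hL, hLα⟩ := hαne
    exact (hLstarMin L hL).trans hLα
  obtain ⟨y, hy, hyY⟩ := exists_smul_one_le_gramian hn hR hObs hα.le
  have hyL : ∀ L ∈ S, J L ≤ α → y • 1 ≤ Y L := fun L hL hLα =>
    hyY L (Y L) (hYps L hL) (hYL L hL) ((hYJ L hL).trans hLα)
  -- The minimizer is stationary: otherwise a small step along `E` stays stabilizing and improves it.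
  have hEstar : -(Lstar * R) + (A - Lstar * H) * X Lstar * Hᵀ = 0 := by
    set E := -(Lstar * R) + (A - Lstar * H) * X Lstar * Hᵀ with hE
    set N := H * X Lstar * Hᵀ + R with hN
    have hXpd : (X Lstar).PosDef := by
      rw [hXL Lstar hLstarS, add_comm, add_assoc]
      exact hQ.add_posSemidef ((posSemidef_mul_mul_transpose hR.posSemidef _).add
        (posSemidef_mul_mul_transpose (hXps _ hLstarS) _))
    have hNps : N.PosSemidef :=
      (posSemidef_mul_mul_transpose (hXps _ hLstarS) _).add hR.posSemidef
    have hEE : (E * Eᵀ).PosSemidef := by simpa using posSemidef_self_mul_conjTranspose E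
    have htr := hNps.trace_nonneg
    set s : ℝ := (1 + N.trace)⁻¹ with hs
    have hs0 : 0 < s := by positivity
    have hsN : s * N.trace + s = 1 := by rw [hs]; field_simp; ring
    have h1 : (1 - s • N).PosSemidef := by
      have h := (PosSemidef.smul (le_trace_smul_one hNps) hs0.le).add
        (PosSemidef.one.smul hs0.le : (s • (1 : Matrix (Fin m) (Fin m) ℝ)).PosSemidef)
      rwa [smul_sub, smul_smul, sub_add_eq_add_sub, ← add_smul, hsN, one_smul] at h
    set W := s • E * N * (s • E)ᵀ - E * (s • E)ᵀ - s • E * Eᵀ with hW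
    have hWE : s • (E * Eᵀ) ≤ -W := by
      have h := (posSemidef_mul_mul_transpose h1 E).smul hs0.le
      rw [Matrix.le_iff]
      refine (congrArg PosSemidef ?_).mp h
      rw [hW]
      simp only [transpose_smul, Matrix.mul_sub, Matrix.sub_mul, Matrix.mul_smul, Matrix.smul_mul,
        Matrix.mul_one, Matrix.mul_assoc]
      module
    have hWps : (-W).PosSemidef := by
      have h := PosSemidef.add hWE (hEE.smul hs0.le)
      rwa [sub_add_cancel] at h
    have hpert := riccati_perturbation (Q := Q) (D := s • E)
      (by simpa using (hXps _ hLstarS).isHermitian.eq) hRt hE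
    rw [← hXL _ hLstarS, ← hN, ← hW] at hpert
    have hmem : Lstar + s • E ∈ S := by
      rw [hS]
      refine specRad_lt_one_of_lyapunov hn hXpd ?_
      have h : X Lstar - (A - (Lstar + s • E) * H) * X Lstar * (A - (Lstar + s • E) * H)ᵀ =
          Q + (Lstar + s • E) * R * (Lstar + s • E)ᵀ + -W := by
        rw [eq_sub_of_add_eq hpert]
        abel
      rw [h]
      exact (hQ.add_posSemidef (posSemidef_mul_mul_transpose hR.posSemidef _)).add_posSemidef hWps
    have hdiff := hsub Lstar hLstarS (s • E) hmem E hE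
    rw [← hN, ← hW] at hdiff
    have hmin := hLstarMin _ hmem
    have h2 := trace_mul_le_trace_mul_right (hYps _ hmem) hWE
    have h3 := trace_mul_nonneg_of_posSemidef (hYps _ hmem) hWps
    rw [Matrix.mul_neg, trace_neg] at h2 h3
    have hle := hyL _ hmem (by linarith)
    have h4 := trace_mul_le_trace_mul_left hle hEE
    rw [Matrix.smul_mul, Matrix.one_mul, trace_smul, smul_eq_mul] at h4
    rw [Matrix.mul_smul, trace_smul, smul_eq_mul] at h2
    have h5 : s * (y * (E * Eᵀ).trace) ≤ 0 := by nlinarith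
    have h6 := hEE.trace_nonneg
    have h7 : (E * Eᵀ).trace = 0 := by
      by_contra hne
      have : 0 < (E * Eᵀ).trace := lt_of_le_of_ne h6 (Ne.symm hne)
      have : 0 < s * (y * (E * Eᵀ).trace) := by positivity
      linarith
    rw [← conjTranspose_eq_transpose_of_trivial] at h7
    exact trace_mul_conjTranspose_self_eq_zero_iff.mp h7
  set K : ℝ := r⁻¹ * (Y Lstar).trace with hK
  have hK0 : 0 ≤ K := mul_nonneg (inv_nonneg.mpr hr.le) (hYps _ hLstarS).trace_nonneg
  refine ⟨2 * y ^ 2 / (K + 1), by positivity, 2 * y ^ 2 / (K + 1) * (y * r), by positivity,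
    fun L hL hLα => ?_⟩
  rw [frobNorm_sq, frobNorm_sq]
  set E := -(L * R) + (A - L * H) * X L * Hᵀ with hE
  set e := (Eᵀ * E).trace with he
  set d := ((L - Lstar)ᵀ * (L - Lstar)).trace with hd
  have he0 : 0 ≤ e := trace_transpose_mul_self_nonneg E
  have hG4 : 4 * (y ^ 2 * e) ≤ ((G L)ᵀ * G L).trace := by
    have h := sq_mul_trace_le_of_smul_one_le (hYps L hL) hy.le (hyL L hL hLα) E
    rw [hG, ← hE, transpose_smul, Matrix.smul_mul, Matrix.mul_smul, trace_smul, trace_smul,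
      smul_eq_mul, smul_eq_mul]
    linarith
  have hupper : J L - J Lstar ≤ K * e := by
    have h := hsub L hL (Lstar - L) (by rwa [add_sub_cancel]) E hE
    rw [add_sub_cancel] at h
    have h' := neg_trace_le_of_smul_one_le (hYps _ hLstarS) hr (hNr L hL) (Lstar - L) E
    rw [← h, ← mul_assoc] at h'
    linarith
  have hlower : y * r * d ≤ J L - J Lstar := by
    have h := hsub Lstar hLstarS (L - Lstar) (by rwa [add_sub_cancel]) 0 hEstar.symm
    rw [add_sub_cancel] at h
    rw [h, Matrix.zero_mul, transpose_zero, Matrix.mul_zero, sub_zero, sub_zero]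
    have hDD : ((L - Lstar) * (L - Lstar)ᵀ).PosSemidef := by
      rw [← conjTranspose_eq_transpose_of_trivial]
      exact posSemidef_self_mul_conjTranspose _
    have h1 := trace_mul_le_trace_mul_right (hYps L hL)
      (mul_mul_transpose_mono (hNr Lstar hLstarS) (L - Lstar))
    have h2 := trace_mul_le_trace_mul_left (hyL L hL hLα) hDD
    rw [Matrix.smul_mul, Matrix.one_mul, trace_smul, smul_eq_mul, trace_mul_comm, ← hd] at h2
    rw [Matrix.mul_smul, Matrix.mul_one, Matrix.smul_mul, Matrix.mul_smul, trace_smul,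
      smul_eq_mul] at h1
    nlinarith [mul_le_mul_of_nonneg_left h2 hr.le]
  have hc : 2 * y ^ 2 / (K + 1) * (K * e) ≤ 2 * y ^ 2 * e := by
    rw [div_mul_eq_mul_div, div_le_iff₀ (by positivity)]
    have : 0 ≤ 2 * y ^ 2 * e := by positivity
    linarith
  have hc0 : 0 ≤ 2 * y ^ 2 / (K + 1) := by positivity
  have h1 := mul_le_mul_of_nonneg_left hupper hc0
  have h2 := mul_le_mul_of_nonneg_left (hlower.trans hupper) hc0
  rw [mul_assoc (2 * y ^ 2 / (K + 1)) (y * r) d]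
  linarith
end

section
/- Suppose the pair (A, H) is observable. Then for every α > 0 with S_α nonempty there exists a constant ℓ > 0 (depending only on α and the problem data) such that for all L₁, L₂ ∈ S_α: ‖G(L₁) − G(L₂)‖_F ≤ ℓ·‖L₁ − L₂‖_F. -/
open Matrix Filter Topology

open scoped MatrixOrder in
lemma Matrix.PosSemidef.exists_eq_transpose_mul_self {k : ℕ} {Q : Matrix (Fin k) (Fin k) ℝ}
    (hQ : Q.PosSemidef) : ∃ B : Matrix (Fin k) (Fin k) ℝ, Q = Bᵀ * B := by
  obtain ⟨B, hB⟩ := CStarAlgebra.nonneg_iff_eq_star_mul_self.mp hQ.nonneg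
  exact ⟨B, by rw [hB, star_eq_conjTranspose, conjTranspose_eq_transpose_of_trivial]⟩

open scoped Matrix.Norms.Frobenius

lemma frobNorm_eq_norm {k l : ℕ} (M : Matrix (Fin k) (Fin l) ℝ) : frobNorm M = ‖M‖ := by
  rw [frobNorm, Matrix.frobenius_norm_def, ← Real.sqrt_eq_rpow, Finset.sum_comm]
  simp [Matrix.trace, Matrix.mul_apply, pow_two]

lemma trace_mul_transpose_self {k l : ℕ} (M : Matrix (Fin k) (Fin l) ℝ) :
    trace (M * Mᵀ) = ‖M‖ ^ 2 := by
  rw [← Matrix.frobenius_norm_transpose M, ← frobNorm_eq_norm, frobNorm, Matrix.transpose_transpose,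
    Real.sq_sqrt]
  simp only [Matrix.trace, Matrix.diag, Matrix.mul_apply, Matrix.transpose_apply]
  exact Finset.sum_nonneg fun _ _ => Finset.sum_nonneg fun _ _ => mul_self_nonneg _

/-- The powers of a Schur stable matrix are square summable. -/
lemma summable_norm_pow_sq {n : ℕ} {M : Matrix (Fin n) (Fin n) ℝ} (hM : specRad M < 1) :
    Summable fun t : ℕ => ‖M ^ t‖ ^ 2 := by
  obtain ⟨r, hr, hr1⟩ := ENNReal.lt_iff_exists_nnreal_btwn.1 hM
  have hr1 : r < 1 := by exact_mod_cast hr1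
  have : CompleteSpace (Matrix (Fin n) (Fin n) ℂ) := FiniteDimensional.complete ℂ _
  have h := spectrum.pow_nnnorm_pow_one_div_tendsto_nhds_spectralRadius (M.map Complex.ofReal)
  have hev := (h.eventually_lt_const hr).and (eventually_gt_atTop 0)
  refine Summable.of_norm_bounded_eventually_nat (g := fun t => ((r : ℝ) ^ 2) ^ t)
    (summable_geometric_of_lt_one (by positivity) (pow_lt_one₀ r.2 (by exact_mod_cast hr1) two_ne_zero)) ?_
  filter_upwards [hev] with t ht
  obtain ⟨ht, ht0⟩ := ht
  have ht0' : (0 : ℝ) < t := by exact_mod_cast ht0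
  rw [one_div, ENNReal.rpow_inv_lt_iff ht0', ENNReal.rpow_natCast] at ht
  have ht2 : ‖(M.map Complex.ofReal) ^ t‖ ≤ (r : ℝ) ^ t := by
    have : ‖(M.map Complex.ofReal) ^ t‖₊ < r ^ t := by exact_mod_cast ht
    exact_mod_cast this.le
  have hmap : (M.map Complex.ofReal) ^ t = (M ^ t).map Complex.ofReal :=
    (map_pow (Complex.ofRealHom.mapMatrix) M t).symm
  rw [hmap, Matrix.frobenius_norm_map_eq _ _ Complex.norm_real] at ht2
  rw [Real.norm_of_nonneg (by positivity), ← pow_mul, mul_comm, pow_mul]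
  exact pow_le_pow_left₀ (norm_nonneg _) ht2 2

lemma norm_conj_pow_le {n : ℕ} (F W : Matrix (Fin n) (Fin n) ℝ) (t : ℕ) :
    ‖F ^ t * W * Fᵀ ^ t‖ ≤ ‖F ^ t‖ ^ 2 * ‖W‖ := by
  calc ‖F ^ t * W * Fᵀ ^ t‖ ≤ ‖F ^ t‖ * ‖W‖ * ‖Fᵀ ^ t‖ :=
        (norm_mul_le _ _).trans (by gcongr; exact norm_mul_le _ _)
    _ = ‖F ^ t‖ ^ 2 * ‖W‖ := by
        rw [← Matrix.transpose_pow, Matrix.frobenius_norm_transpose]; ring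

lemma hasSum_lyapunov {n : ℕ} {F : Matrix (Fin n) (Fin n) ℝ}
    (hF : Summable fun t : ℕ => ‖F ^ t‖ ^ 2) (W : Matrix (Fin n) (Fin n) ℝ) :
    HasSum (fun t : ℕ => F ^ t * W * Fᵀ ^ t) (∑' t : ℕ, F ^ t * W * Fᵀ ^ t) := by
  have : CompleteSpace (Matrix (Fin n) (Fin n) ℝ) := FiniteDimensional.complete ℝ _
  exact (Summable.of_norm_bounded (hF.mul_right ‖W‖) (norm_conj_pow_le F W)).hasSum

lemma lyapunov_equation {n : ℕ} {F : Matrix (Fin n) (Fin n) ℝ}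
    (hF : Summable fun t : ℕ => ‖F ^ t‖ ^ 2) (W : Matrix (Fin n) (Fin n) ℝ) :
    ∑' t : ℕ, F ^ t * W * Fᵀ ^ t = F * (∑' t : ℕ, F ^ t * W * Fᵀ ^ t) * Fᵀ + W := by
  have h := hasSum_lyapunov hF W
  have h1 := ((h.mul_left F).mul_right Fᵀ)
  have h2 := (hasSum_nat_add_iff' 1).2 h
  simp only [Finset.range_one, Finset.sum_singleton, pow_zero, one_mul, mul_one] at h2
  refine sub_eq_iff_eq_add.1 (h2.unique ?_)
  refine h1.congr_fun ?_
  intro t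
  simp only [pow_succ' F, pow_succ Fᵀ, mul_assoc]

/-- Quantitative uniqueness for the discrete Lyapunov equation. -/
lemma norm_le_of_lyapunov {n : ℕ} {F Z D : Matrix (Fin n) (Fin n) ℝ}
    (hF : Summable fun t : ℕ => ‖F ^ t‖ ^ 2) (hZ : Z = F * Z * Fᵀ + D) :
    ‖Z‖ ≤ (∑' t : ℕ, ‖F ^ t‖ ^ 2) * ‖D‖ := by
  have hN : ∀ N : ℕ, Z = F ^ N * Z * Fᵀ ^ N + ∑ t ∈ Finset.range N, F ^ t * D * Fᵀ ^ t := by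
    intro N
    induction N with
    | zero => simp
    | succ N ih =>
      conv_lhs => rw [ih, hZ]
      rw [Finset.sum_range_succ, pow_succ F, pow_succ' Fᵀ]
      noncomm_ring
  have hb : ∀ N : ℕ, ‖Z‖ ≤ ‖F ^ N‖ ^ 2 * ‖Z‖ + (∑' t : ℕ, ‖F ^ t‖ ^ 2) * ‖D‖ := by
    intro N
    conv_lhs => rw [hN N]
    refine (norm_add_le _ _).trans (add_le_add (norm_conj_pow_le _ _ _) ?_)
    refine (norm_sum_le_of_le _ fun t _ => norm_conj_pow_le F D t).trans ?_
    rw [← Finset.sum_mul]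
    gcongr
    exact hF.sum_le_tsum _ fun _ _ => by positivity
  refine ge_of_tendsto' (x := atTop) ?_ hb
  simpa using (hF.tendsto_atTop_zero.mul_const ‖Z‖).add_const ((∑' t : ℕ, ‖F ^ t‖ ^ 2) * ‖D‖)

/-- Positive definite weights dominate a multiple of the Frobenius norm. -/
lemma exists_norm_sq_le_trace {k : ℕ} {Q : Matrix (Fin k) (Fin k) ℝ} (hQ : Q.PosDef) :
    ∃ c > 0, ∀ {a : ℕ} (M : Matrix (Fin a) (Fin k) ℝ), ‖M‖ ^ 2 ≤ c * trace (M * Q * Mᵀ) := by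
  obtain ⟨B, hB⟩ := hQ.posSemidef.exists_eq_transpose_mul_self
  have hu : IsUnit (Bᵀ).det := by
    have := (Matrix.isUnit_iff_isUnit_det _).1 hQ.isUnit
    rw [hB, Matrix.det_mul] at this
    exact isUnit_of_mul_isUnit_left this
  refine ⟨‖(Bᵀ)⁻¹‖ ^ 2 + 1, by positivity, fun M => ?_⟩
  have h1 : trace (M * Q * Mᵀ) = ‖M * Bᵀ‖ ^ 2 := by
    rw [← trace_mul_transpose_self, hB, Matrix.transpose_mul, Matrix.transpose_transpose]
    simp only [Matrix.mul_assoc]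
  have h2 : ‖M‖ ≤ ‖M * Bᵀ‖ * ‖(Bᵀ)⁻¹‖ := by
    conv_lhs => rw [← Matrix.mul_nonsing_inv_cancel_right Bᵀ M hu]
    exact Matrix.frobenius_norm_mul _ _
  rw [h1]
  calc ‖M‖ ^ 2 ≤ (‖M * Bᵀ‖ * ‖(Bᵀ)⁻¹‖) ^ 2 := by gcongr
    _ ≤ (‖(Bᵀ)⁻¹‖ ^ 2 + 1) * ‖M * Bᵀ‖ ^ 2 := by nlinarith [sq_nonneg ‖M * Bᵀ‖]

lemma exists_left_inverse_of_observable {n m : ℕ} (A : Matrix (Fin n) (Fin n) ℝ)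
    (H : Matrix (Fin m) (Fin n) ℝ)
    (hObs : ∀ v : Fin n → ℝ, (∀ t < n, (H * A ^ t) *ᵥ v = 0) → v = 0) :
    ∃ P : ℕ → Matrix (Fin n) (Fin m) ℝ, ∑ t ∈ Finset.range n, P t * (H * A ^ t) = 1 := by
  set W : Matrix (Fin n) (Fin n) ℝ := ∑ t ∈ Finset.range n, (H * A ^ t)ᵀ * (H * A ^ t) with hW
  have hdet : IsUnit W.det := by
    rw [isUnit_iff_ne_zero]
    intro h0
    obtain ⟨v, hv, hWv⟩ := Matrix.exists_mulVec_eq_zero_iff.2 h0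
    refine hv (hObs v fun t ht => ?_)
    have hsum : ∑ t ∈ Finset.range n, ((H * A ^ t) *ᵥ v) ⬝ᵥ ((H * A ^ t) *ᵥ v) = 0 := by
      have : v ⬝ᵥ (W *ᵥ v) = 0 := by simp [hWv]
      rw [hW, Matrix.sum_mulVec, dotProduct_sum] at this
      rw [← this]
      refine Finset.sum_congr rfl fun t _ => ?_
      rw [← Matrix.mulVec_mulVec v (H * A ^ t)ᵀ, Matrix.dotProduct_mulVec v, Matrix.vecMul_transpose]
    have := (Finset.sum_eq_zero_iff_of_nonneg fun t _ =>
      Finset.sum_nonneg fun i _ => mul_self_nonneg (((H * A ^ t) *ᵥ v) i)).1 hsum t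
      (Finset.mem_range.2 ht)
    exact dotProduct_self_eq_zero.1 this
  refine ⟨fun t => W⁻¹ * (H * A ^ t)ᵀ, ?_⟩
  simp only [Matrix.mul_assoc W⁻¹]
  rw [← Finset.mul_sum, ← hW, Matrix.nonsing_inv_mul _ hdet]

/-- Uniform observability: as long as the Markov parameters of `(A - L H, L, H)` stay bounded,
the observability constant of `(A - L H, H)` does not depend on `L`. -/
lemma exists_uniform_observability {n m : ℕ} (A : Matrix (Fin n) (Fin n) ℝ)
    (H : Matrix (Fin m) (Fin n) ℝ)
    (hObs : ∀ v : Fin n → ℝ, (∀ t < n, (H * A ^ t) *ᵥ v = 0) → v = 0) {β : ℝ} (hβ : 0 ≤ β) :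
    ∃ C ≥ 0, ∀ L : Matrix (Fin n) (Fin m) ℝ, (∀ j, ‖H * (A - L * H) ^ j * L‖ ≤ β) →
      ∀ {k : ℕ} (M : Matrix (Fin n) (Fin k) ℝ) (μ : ℝ),
        (∀ j < n, ‖H * (A - L * H) ^ j * M‖ ≤ μ) → ‖M‖ ≤ C * μ := by
  obtain ⟨P, hP⟩ := exists_left_inverse_of_observable A H hObs
  refine ⟨∑ t ∈ Finset.range n, ‖P t‖ * (1 + β) ^ t, by positivity, fun L hL k M μ hM => ?_⟩
  have key : ∀ t j, j + t < n → ‖H * (A - L * H) ^ j * A ^ t * M‖ ≤ (1 + β) ^ t * μ := by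
    intro t
    induction t with
    | zero => intro j hj; simpa using hM j hj
    | succ t ih =>
      intro j hj
      have e : H * (A - L * H) ^ j * A ^ (t + 1) * M =
          H * (A - L * H) ^ (j + 1) * A ^ t * M +
            (H * (A - L * H) ^ j * L) * (H * (A - L * H) ^ 0 * A ^ t * M) := by
        have : A ^ (t + 1) = (A - L * H) * A ^ t + L * H * A ^ t := by
          rw [← add_mul, sub_add_cancel, pow_succ']
        rw [this, pow_succ, pow_zero]
        simp only [Matrix.mul_add, Matrix.add_mul, Matrix.mul_assoc, Matrix.mul_one]
      rw [e]
      calc _ ≤ (1 + β) ^ t * μ + β * ((1 + β) ^ t * μ) := by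
            refine (norm_add_le _ _).trans (add_le_add (ih _ (by omega)) ?_)
            refine (Matrix.frobenius_norm_mul _ _).trans ?_
            exact mul_le_mul (hL j) (ih 0 (by omega)) (norm_nonneg _) hβ
        _ = (1 + β) ^ (t + 1) * μ := by ring
  have hMe : M = ∑ t ∈ Finset.range n, P t * (H * (A - L * H) ^ 0 * A ^ t * M) := by
    conv_lhs => rw [← Matrix.one_mul M, ← hP, Matrix.sum_mul]
    simp [Matrix.mul_assoc]
  conv_lhs => rw [hMe]
  rw [Finset.sum_mul]
  refine norm_sum_le_of_le _ fun t ht => (Matrix.frobenius_norm_mul _ _).trans ?_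
  rw [mul_assoc]
  gcongr
  exact key t 0 (by simpa using ht)

/-- The function `f` is bounded and Lipschitz on `s`. -/
def BddLipOn {E F : Type*} [NormedAddCommGroup E] [NormedAddCommGroup F] (s : Set E) (f : E → F) :
    Prop :=
  ∃ K : ℝ, ∀ x ∈ s, ‖f x‖ ≤ K ∧ ∀ y ∈ s, ‖f x - f y‖ ≤ K * ‖x - y‖

namespace BddLipOn

variable {E F : Type*} [NormedAddCommGroup E] [NormedAddCommGroup F] {s : Set E} {a b c : ℕ}

lemma const (M : F) : BddLipOn s fun _ => M :=
  ⟨‖M‖, fun _ _ => ⟨le_rfl, fun _ _ => by rw [sub_self, norm_zero]; positivity⟩⟩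

lemma add {f g : E → F} (hf : BddLipOn s f) (hg : BddLipOn s g) :
    BddLipOn s fun x => f x + g x := by
  obtain ⟨K, hK⟩ := hf
  obtain ⟨K', hK'⟩ := hg
  refine ⟨K + K', fun x hx => ⟨norm_add_le_of_le (hK x hx).1 (hK' x hx).1, fun y hy => ?_⟩⟩
  rw [add_sub_add_comm, add_mul]
  exact norm_add_le_of_le ((hK x hx).2 y hy) ((hK' x hx).2 y hy)

lemma neg {f : E → F} (hf : BddLipOn s f) : BddLipOn s fun x => -f x := by
  obtain ⟨K, hK⟩ := hf
  refine ⟨K, fun x hx => ⟨by rw [norm_neg]; exact (hK x hx).1, fun y hy => ?_⟩⟩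
  rw [neg_sub_neg, norm_sub_rev]
  exact (hK x hx).2 y hy

lemma sub {f g : E → F} (hf : BddLipOn s f) (hg : BddLipOn s g) :
    BddLipOn s fun x => f x - g x := by
  simpa only [sub_eq_add_neg] using hf.add hg.neg

lemma transpose {f : E → Matrix (Fin a) (Fin b) ℝ} (hf : BddLipOn s f) :
    BddLipOn s fun x => (f x)ᵀ := by
  obtain ⟨K, hK⟩ := hf
  refine ⟨K, fun x hx => ?_⟩
  simp only [← Matrix.transpose_sub, Matrix.frobenius_norm_transpose]
  exact hK x hx

lemma mul {f : E → Matrix (Fin a) (Fin b) ℝ} {g : E → Matrix (Fin b) (Fin c) ℝ}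
    (hf : BddLipOn s f) (hg : BddLipOn s g) : BddLipOn s fun x => f x * g x := by
  obtain ⟨K, hK⟩ := hf
  obtain ⟨K', hK'⟩ := hg
  refine ⟨2 * (K * K'), fun x hx => ?_⟩
  have hK0 : 0 ≤ K := (norm_nonneg _).trans (hK x hx).1
  have hK'0 : 0 ≤ K' := (norm_nonneg _).trans (hK' x hx).1
  constructor
  · calc ‖f x * g x‖ ≤ ‖f x‖ * ‖g x‖ := Matrix.frobenius_norm_mul _ _
      _ ≤ K * K' := mul_le_mul (hK x hx).1 (hK' x hx).1 (norm_nonneg _) hK0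
      _ ≤ 2 * (K * K') := by linarith [mul_nonneg hK0 hK'0]
  · intro y hy
    have e : f x * g x - f y * g y = (f x - f y) * g x + f y * (g x - g y) := by
      rw [Matrix.sub_mul, Matrix.mul_sub]; abel
    calc ‖f x * g x - f y * g y‖ ≤ ‖f x - f y‖ * ‖g x‖ + ‖f y‖ * ‖g x - g y‖ := by
          rw [e]
          exact norm_add_le_of_le (Matrix.frobenius_norm_mul _ _) (Matrix.frobenius_norm_mul _ _)
      _ ≤ (K * ‖x - y‖) * K' + K * (K' * ‖x - y‖) := by
          gcongr
          exacts [(hK x hx).2 y hy, (hK' x hx).1, (hK y hy).1, (hK' x hx).2 y hy]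
      _ = 2 * (K * K') * ‖x - y‖ := by ring

/-- Solutions of Lyapunov equations with bounded Lipschitz data and uniformly square summable
powers are bounded and Lipschitz. -/
lemma lyapunov {f w z : E → Matrix (Fin a) (Fin a) ℝ} (hf : BddLipOn s f) (hw : BddLipOn s w)
    {σ : ℝ} (hsum : ∀ x ∈ s, Summable fun t : ℕ => ‖f x ^ t‖ ^ 2)
    (hσ : ∀ x ∈ s, ∑' t : ℕ, ‖f x ^ t‖ ^ 2 ≤ σ) (hz : ∀ x ∈ s, z x = f x * z x * (f x)ᵀ + w x) :
    BddLipOn s z := by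
  obtain ⟨K, hK⟩ := hf
  obtain ⟨K', hK'⟩ := hw
  have hzb : ∀ x ∈ s, ‖z x‖ ≤ σ * K' := fun x hx =>
    (norm_le_of_lyapunov (hsum x hx) (hz x hx)).trans
      (mul_le_mul (hσ x hx) (hK' x hx).1 (norm_nonneg _)
        ((tsum_nonneg fun _ => by positivity).trans (hσ x hx)))
  set B := σ * K'
  refine ⟨max B (σ * (2 * K * B * K + K')), fun x hx => ⟨(hzb x hx).trans (le_max_left _ _),
    fun y hy => ?_⟩⟩
  have hK0 : 0 ≤ K := (norm_nonneg _).trans (hK x hx).1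
  have hB0 : 0 ≤ B := (norm_nonneg _).trans (hzb x hx)
  have hσ0 : 0 ≤ σ := (tsum_nonneg fun _ => by positivity).trans (hσ x hx)
  have e : z x - z y = f x * (z x - z y) * (f x)ᵀ +
      ((f x - f y) * z y * (f x)ᵀ + f y * z y * (f x - f y)ᵀ + (w x - w y)) := by
    conv_lhs => rw [hz x hx, hz y hy]
    rw [Matrix.transpose_sub]
    noncomm_ring
  have hd : ‖(f x - f y) * z y * (f x)ᵀ + f y * z y * (f x - f y)ᵀ + (w x - w y)‖ ≤
      (2 * K * B * K + K') * ‖x - y‖ := by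
    calc _ ≤ ‖f x - f y‖ * ‖z y‖ * ‖(f x)ᵀ‖ + ‖f y‖ * ‖z y‖ * ‖(f x - f y)ᵀ‖ + ‖w x - w y‖ :=
          norm_add_le_of_le (norm_add_le_of_le (norm_mul₃_le) (norm_mul₃_le)) le_rfl
      _ ≤ (K * ‖x - y‖) * B * K + K * B * (K * ‖x - y‖) + K' * ‖x - y‖ := by
          rw [Matrix.frobenius_norm_transpose, Matrix.frobenius_norm_transpose]
          gcongr
          exacts [(hK x hx).2 y hy, hzb y hy, (hK x hx).1, (hK y hy).1, hzb y hy,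
            (hK x hx).2 y hy, (hK' x hx).2 y hy]
      _ = _ := by ring
  calc ‖z x - z y‖ ≤ σ * ((2 * K * B * K + K') * ‖x - y‖) :=
        (norm_le_of_lyapunov (hsum x hx) e).trans (mul_le_mul (hσ x hx) hd (norm_nonneg _) hσ0)
    _ = σ * (2 * K * B * K + K') * ‖x - y‖ := by ring
    _ ≤ _ := by gcongr; exact le_max_right _ _

end BddLipOn

/-- Bounds on the impulse responses of the closed loop in terms of the cost. -/
lemma impulse_response_bounds {n m : ℕ} {F Q : Matrix (Fin n) (Fin n) ℝ}
    {H : Matrix (Fin m) (Fin n) ℝ} {R : Matrix (Fin m) (Fin m) ℝ} {L : Matrix (Fin n) (Fin m) ℝ}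
    {cQ cR : ℝ} (hcQ : 0 < cQ) (hcR : 0 < cR)
    (hQ : ∀ {a : ℕ} (M : Matrix (Fin a) (Fin n) ℝ), ‖M‖ ^ 2 ≤ cQ * trace (M * Q * Mᵀ))
    (hR : ∀ {a : ℕ} (M : Matrix (Fin a) (Fin m) ℝ), ‖M‖ ^ 2 ≤ cR * trace (M * R * Mᵀ))
    (hF : Summable fun t : ℕ => ‖F ^ t‖ ^ 2) {α : ℝ}
    (hJ : trace ((∑' t : ℕ, F ^ t * (Q + L * R * Lᵀ) * Fᵀ ^ t) * Hᵀ * H) ≤ α) :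
    (∀ s : Finset ℕ, ∑ t ∈ s, ‖H * F ^ t‖ ^ 2 ≤ cQ * α) ∧
      ∀ t, ‖H * F ^ t * L‖ ^ 2 ≤ cR * α := by
  have hq : ∀ {a : ℕ} (M : Matrix (Fin a) (Fin n) ℝ), 0 ≤ trace (M * Q * Mᵀ) := fun M =>
    nonneg_of_mul_nonneg_right ((sq_nonneg _).trans (hQ M)) hcQ
  have hr : ∀ {a : ℕ} (M : Matrix (Fin a) (Fin m) ℝ), 0 ≤ trace (M * R * Mᵀ) := fun M =>
    nonneg_of_mul_nonneg_right ((sq_nonneg _).trans (hR M)) hcR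
  set q : ℕ → ℝ := fun t => trace (H * F ^ t * Q * (H * F ^ t)ᵀ)
  set r : ℕ → ℝ := fun t => trace (H * F ^ t * L * R * (H * F ^ t * L)ᵀ)
  have hterm : ∀ t, trace (F ^ t * (Q + L * R * Lᵀ) * Fᵀ ^ t * Hᵀ * H) = q t + r t := by
    intro t
    rw [Matrix.trace_mul_comm, ← Matrix.trace_add]
    congr 1
    simp only [Matrix.transpose_mul, Matrix.transpose_pow, Matrix.mul_add, Matrix.add_mul,
      Matrix.mul_assoc]
  let φ : Matrix (Fin n) (Fin n) ℝ →ₗ[ℝ] ℝ :=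
    { toFun := fun Z => trace (Z * Hᵀ * H)
      map_add' := fun Z Z' => by simp [Matrix.add_mul]
      map_smul' := fun c Z => by simp }
  have hsum : HasSum (fun t => q t + r t)
      (trace ((∑' t : ℕ, F ^ t * (Q + L * R * Lᵀ) * Fᵀ ^ t) * Hᵀ * H)) := by
    simp only [← hterm]
    exact (hasSum_lyapunov hF _).map φ φ.continuous_of_finiteDimensional
  have hfin : ∀ s : Finset ℕ, ∑ t ∈ s, (q t + r t) ≤ α := fun s =>
    (sum_le_hasSum s (fun t _ => add_nonneg (hq _) (hr _)) hsum).trans hJ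
  refine ⟨fun s => ?_, fun t => ?_⟩
  · calc ∑ t ∈ s, ‖H * F ^ t‖ ^ 2 ≤ ∑ t ∈ s, cQ * (q t + r t) :=
          Finset.sum_le_sum fun t _ => (hQ _).trans (by gcongr; exact le_add_of_nonneg_right (hr _))
      _ ≤ cQ * α := by rw [← Finset.mul_sum]; gcongr; exact hfin s
  · refine (hR _).trans ?_
    gcongr
    exact (le_add_of_nonneg_left (hq (H * F ^ t))).trans (by simpa only [Finset.sum_singleton] using hfin {t})

/-- On a sublevel set the gains are bounded and the closed loop powers are uniformly square
summable. -/
lemma exists_uniform_bounds {n m : ℕ} {A Q : Matrix (Fin n) (Fin n) ℝ}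
    {H : Matrix (Fin m) (Fin n) ℝ} {R : Matrix (Fin m) (Fin m) ℝ}
    (hQ : Q.PosDef) (hR : R.PosDef)
    (hObs : ∀ v : Fin n → ℝ, (∀ t < n, (H * A ^ t) *ᵥ v = 0) → v = 0) (α : ℝ) :
    ∃ K σ : ℝ, ∀ L : Matrix (Fin n) (Fin m) ℝ, specRad (A - L * H) < 1 →
      trace ((∑' t : ℕ, (A - L * H) ^ t * (Q + L * R * Lᵀ) * (A - L * H)ᵀ ^ t) * Hᵀ * H) ≤ α →
      ‖L‖ ≤ K ∧ ∑' t : ℕ, ‖(A - L * H) ^ t‖ ^ 2 ≤ σ := by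
  obtain ⟨cQ, hcQ, hQ⟩ := exists_norm_sq_le_trace hQ
  obtain ⟨cR, hcR, hR⟩ := exists_norm_sq_le_trace hR
  obtain ⟨C, hC, hobs⟩ := exists_uniform_observability A H hObs (Real.sqrt_nonneg (cR * α))
  refine ⟨C * √(cR * α), C ^ 2 * (n * (cQ * α)), fun L hL hJ => ?_⟩
  have hs := summable_norm_pow_sq hL
  obtain ⟨h1, h2⟩ := impulse_response_bounds hcQ hcR hQ hR hs hJ
  have h2' : ∀ j, ‖H * (A - L * H) ^ j * L‖ ≤ √(cR * α) := fun j => Real.le_sqrt_of_sq_le (h2 j)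
  refine ⟨hobs L h2' L _ fun j _ => h2' j, hs.tsum_le_of_sum_range_le fun N => ?_⟩
  have hpt : ∀ t, ‖(A - L * H) ^ t‖ ^ 2 ≤
      C ^ 2 * ∑ j ∈ Finset.range n, ‖H * (A - L * H) ^ (j + t)‖ ^ 2 := by
    intro t
    have := hobs L h2' ((A - L * H) ^ t)
      √(∑ j ∈ Finset.range n, ‖H * (A - L * H) ^ (j + t)‖ ^ 2) fun j hj => by
        rw [Matrix.mul_assoc, ← pow_add]
        exact Real.le_sqrt_of_sq_le (Finset.single_le_sum
          (f := fun j => ‖H * (A - L * H) ^ (j + t)‖ ^ 2)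
          (fun _ _ => by positivity) (Finset.mem_range.2 hj))
    calc _ ≤ (C * √(∑ j ∈ Finset.range n, ‖H * (A - L * H) ^ (j + t)‖ ^ 2)) ^ 2 := by gcongr
      _ = _ := by rw [mul_pow, Real.sq_sqrt (by positivity)]
  calc _ ≤ ∑ t ∈ Finset.range N, C ^ 2 * ∑ j ∈ Finset.range n, ‖H * (A - L * H) ^ (j + t)‖ ^ 2 :=
        Finset.sum_le_sum fun t _ => hpt t
    _ = C ^ 2 * ∑ j ∈ Finset.range n, ∑ t ∈ Finset.range N, ‖H * (A - L * H) ^ (j + t)‖ ^ 2 := by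
        rw [← Finset.mul_sum, Finset.sum_comm]
    _ ≤ C ^ 2 * ∑ j ∈ Finset.range n, cQ * α := by
        gcongr with j
        refine le_trans (le_of_eq ?_) (h1 ((Finset.range N).map (addLeftEmbedding j)))
        rw [Finset.sum_map]
        rfl
    _ = _ := by simp

theorem stmt_11 {n m : ℕ} (hn : 0 < n) (hm : 0 < m)
    (A : Matrix (Fin n) (Fin n) ℝ) (H : Matrix (Fin m) (Fin n) ℝ)
    (Q : Matrix (Fin n) (Fin n) ℝ) (R : Matrix (Fin m) (Fin m) ℝ)
    (hQ : Q.PosDef) (hR : R.PosDef)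
    (hObs : ∀ v : Fin n → ℝ,
      (∀ t : ℕ, t ≤ n - 1 → H.mulVec ((A ^ t).mulVec v) = 0) → v = 0)
    (S : Set (Matrix (Fin n) (Fin m) ℝ))
    (hS : S = {L | specRad (A - L * H) < 1})
    (X : Matrix (Fin n) (Fin m) ℝ → Matrix (Fin n) (Fin n) ℝ)
    (hX : ∀ L, X L = ∑' t : ℕ, (A - L * H) ^ t * (Q + L * R * Lᵀ) * ((A - L * H)ᵀ) ^ t)
    (Y : Matrix (Fin n) (Fin m) ℝ → Matrix (Fin n) (Fin n) ℝ)
    (hY : ∀ L, Y L = ∑' t : ℕ, ((A - L * H)ᵀ) ^ t * (Hᵀ * H) * (A - L * H) ^ t)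
    (J : Matrix (Fin n) (Fin m) ℝ → ℝ)
    (hJ : ∀ L, J L = Matrix.trace (X L * Hᵀ * H) + Matrix.trace R)
    (G : Matrix (Fin n) (Fin m) ℝ → Matrix (Fin n) (Fin m) ℝ)
    (hG : ∀ L, G L = (2 : ℝ) • (Y L * (-(L * R) + (A - L * H) * X L * Hᵀ)))
    (α : ℝ) (hα : 0 < α) (hαne : {L | L ∈ S ∧ J L ≤ α}.Nonempty) :
    ∃ ℓ > (0 : ℝ), ∀ L₁ L₂ : Matrix (Fin n) (Fin m) ℝ,
      L₁ ∈ S → J L₁ ≤ α → L₂ ∈ S → J L₂ ≤ α →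
      frobNorm (G L₁ - G L₂) ≤ ℓ * frobNorm (L₁ - L₂) := by
  obtain ⟨K, σ, hbound⟩ := exists_uniform_bounds (A := A) (H := H) hQ hR
    (fun v hv => hObs v fun t ht => by
      rw [Matrix.mulVec_mulVec]; exact hv t (by omega)) (α - trace R)
  set s : Set (Matrix (Fin n) (Fin m) ℝ) := {L | L ∈ S ∧ J L ≤ α}
  have hstab : ∀ L ∈ s, specRad (A - L * H) < 1 := by
    rintro L ⟨hL, -⟩
    rwa [hS] at hL
  have hsum : ∀ L ∈ s, Summable fun t : ℕ => ‖(A - L * H) ^ t‖ ^ 2 := fun L hL =>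
    summable_norm_pow_sq (hstab L hL)
  have hb : ∀ L ∈ s, ‖L‖ ≤ K ∧ ∑' t : ℕ, ‖(A - L * H) ^ t‖ ^ 2 ≤ σ := by
    intro L hL
    refine hbound L (hstab L hL) ?_
    have := hL.2
    rw [hJ, hX] at this
    linarith
  have hid : BddLipOn s fun L => L := by
    refine ⟨max K 1, fun L hL => ⟨(hb L hL).1.trans (le_max_left _ _), fun L' _ => ?_⟩⟩
    exact le_mul_of_one_le_left (norm_nonneg _) (le_max_right _ _)
  have hF : BddLipOn s fun L => A - L * H := (BddLipOn.const A).sub (hid.mul (.const H))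
  have hXl : BddLipOn s X := by
    refine hF.lyapunov (w := fun L => Q + L * R * Lᵀ)
      ((BddLipOn.const Q).add ((hid.mul (.const R)).mul hid.transpose)) hsum
      (fun L hL => (hb L hL).2) fun L hL => ?_
    rw [hX]
    exact lyapunov_equation (hsum L hL) _
  have htr : ∀ L : Matrix (Fin n) (Fin m) ℝ, ∀ t : ℕ,
      ‖(A - L * H)ᵀ ^ t‖ = ‖(A - L * H) ^ t‖ := fun L t => by
    rw [← Matrix.transpose_pow, Matrix.frobenius_norm_transpose]
  have hYl : BddLipOn s Y := by
    refine hF.transpose.lyapunov (w := fun _ => Hᵀ * H) (.const _) (σ := σ)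
      (fun L hL => ?_) (fun L hL => ?_) fun L hL => ?_
    · simpa only [htr] using hsum L hL
    · simpa only [htr] using (hb L hL).2
    · rw [hY]
      exact lyapunov_equation (F := (A - L * H)ᵀ) (by simpa only [htr] using hsum L hL) (Hᵀ * H)
  obtain ⟨ℓ, hℓ⟩ := hYl.mul ((hid.mul (.const R)).neg.add ((hF.mul hXl).mul (.const Hᵀ)))
  refine ⟨2 * max ℓ 1, by positivity, fun L₁ L₂ h₁ h₁' h₂ h₂' => ?_⟩
  rw [frobNorm_eq_norm, frobNorm_eq_norm, hG, hG, ← smul_sub, norm_smul, Real.norm_two, mul_assoc]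
  gcongr
  refine ((hℓ L₁ ⟨h₁, h₁'⟩).2 L₂ ⟨h₂, h₂'⟩).trans ?_
  gcongr
  exact le_max_left _ _
end
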